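/- There exist positive constants ε₁, ε₂ and C depending only on λ, Λ, K, C₀ and d, such that: for any 0 < r ≤ 1, any f ∈ L^d(B_{9√d}) ∩ C(B_{9√d}) with ‖f‖_{L^d(B_{9√d})} ≤ ε₁, and any nonnegative bounded lower semicontinuous function u that is a viscosity supersolution of −P⁻(D²u) − P⁻_{K,r}(u) + C₀ r |Du| ≥ f in B_{9√d} with inf_{Q₃} u ≤ 1, one has |Q₁ ∩ B^u_t| ≤ C·t^{−ε₂} for every t > 0 (Lebesgue measure). -/

import Mathlib

open MeasureTheory Metric Set
open scoped RealInnerProductSpace ENNReal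

noncomputable section

/-- `d`-dimensional Euclidean space. -/
abbrev Ed (d : ℕ) : Type := EuclideanSpace ℝ (Fin d)

/-- A real-valued function on `ℝ^d` is bounded. -/
def IsBddFun {d : ℕ} (φ : Ed d → ℝ) : Prop := ∃ M, ∀ x, |φ x| ≤ M

/-- The open cube of half side length `δ` centered at `x`. -/
def cubeAt {d : ℕ} (x : Ed d) (δ : ℝ) : Set (Ed d) := {y | ∀ i, |y i - x i| < δ}

/-- The open cube `Q_δ = (-δ, δ)^d`. -/
def cube (d : ℕ) (δ : ℝ) : Set (Ed d) := cubeAt 0 δ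

/-- Hessian matrix of `φ` at `x` (matrix of second derivatives). -/
def hess {d : ℕ} (φ : Ed d → ℝ) (x : Ed d) : Matrix (Fin d) (Fin d) ℝ :=
  Matrix.of fun i j =>
    iteratedFDeriv ℝ 2 φ x ![EuclideanSpace.single i (1 : ℝ), EuclideanSpace.single j (1 : ℝ)]

/-- Symmetric matrices `A` with `λ I ≤ A ≤ Λ I`. -/
def ellipticSet (lam Lam : ℝ) (d : ℕ) : Set (Matrix (Fin d) (Fin d) ℝ) :=
  {A | A.IsSymm ∧ (A - lam • (1 : Matrix (Fin d) (Fin d) ℝ)).PosSemidef ∧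
      (Lam • (1 : Matrix (Fin d) (Fin d) ℝ) - A).PosSemidef}

/-- The Pucci maximal operator `P⁺`. -/
def pucciPlus {d : ℕ} (lam Lam : ℝ) (X : Matrix (Fin d) (Fin d) ℝ) : ℝ :=
  sSup ((fun A => (A * X).trace) '' ellipticSet lam Lam d)

/-- The Pucci minimal operator `P⁻`. -/
def pucciMinus {d : ℕ} (lam Lam : ℝ) (X : Matrix (Fin d) (Fin d) ℝ) : ℝ :=
  sInf ((fun A => (A * X).trace) '' ellipticSet lam Lam d)

/-- The Lévy kernel condition: `K ≥ 0` measurable with `∫ min(|z|²,1) K(z) dz < ∞`. -/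
def KernCond {d : ℕ} (K : Ed d → ℝ) : Prop :=
  Measurable K ∧ (∀ z, 0 ≤ K z) ∧ Integrable (fun z : Ed d => min (‖z‖ ^ 2) 1 * K z)

/-- The rescaled kernel `K_r(z) = r^{d+2} K(rz)`. -/
def Kresc {d : ℕ} (K : Ed d → ℝ) (r : ℝ) (z : Ed d) : ℝ := r ^ (d + 2) * K (r • z)

/-- The second-order increment `u(x+z) − u(x) − 1_{B_{1/r}}(z) Du(x)·z`. -/
def deltaOp {d : ℕ} (φ : Ed d → ℝ) (r : ℝ) (x z : Ed d) : ℝ :=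
  φ (x + z) - φ x - (Metric.ball (0 : Ed d) (1 / r)).indicator (fun w => ⟪gradient φ x, w⟫) z

/-- The maximal nonlocal Pucci operator `P⁺_{K,r}`. -/
def nlPlus {d : ℕ} (K : Ed d → ℝ) (r : ℝ) (φ : Ed d → ℝ) (x : Ed d) : ℝ :=
  ∫ z, max (deltaOp φ r x z) 0 * Kresc K r z

/-- The minimal nonlocal Pucci operator `P⁻_{K,r}`. -/
def nlMinus {d : ℕ} (K : Ed d → ℝ) (r : ℝ) (φ : Ed d → ℝ) (x : Ed d) : ℝ :=
  -∫ z, max (-deltaOp φ r x z) 0 * Kresc K r z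

/-- Viscosity supersolution of `−P⁻(D²u) − P⁻_{K,r}(u) + C₀ r |Du| ≥ f` in `O`. -/
def SupersolExtremal {d : ℕ} (lam Lam C0 r : ℝ) (K f : Ed d → ℝ) (O : Set (Ed d))
    (u : Ed d → ℝ) : Prop :=
  ∀ φ : Ed d → ℝ, ContDiff ℝ 2 φ → IsBddFun φ → ∀ x ∈ O, (∀ y, φ y ≤ u y) → u x = φ x →
    f x ≤ -pucciMinus lam Lam (hess φ x) - nlMinus K r φ x + C0 * r * ‖gradient φ x‖

/-- Viscosity subsolution of `P⁺(D²u) + P⁺_K(u) + C₀|Du| ≥ g` in `O`. -/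
def SubsolPlus {d : ℕ} (lam Lam C0 : ℝ) (K g : Ed d → ℝ) (O : Set (Ed d)) (u : Ed d → ℝ) : Prop :=
  ∀ φ : Ed d → ℝ, ContDiff ℝ 2 φ → IsBddFun φ → ∀ x ∈ O, (∀ y, u y ≤ φ y) → u x = φ x →
    g x ≤ pucciPlus lam Lam (hess φ x) + nlPlus K 1 φ x + C0 * ‖gradient φ x‖

/-- Viscosity supersolution of `P⁻(D²u) + P⁻_K(u) − C₀|Du| ≤ g` in `O`. -/
def SupersolMinus {d : ℕ} (lam Lam C0 : ℝ) (K g : Ed d → ℝ) (O : Set (Ed d)) (u : Ed d → ℝ) : Prop :=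
  ∀ φ : Ed d → ℝ, ContDiff ℝ 2 φ → IsBddFun φ → ∀ x ∈ O, (∀ y, φ y ≤ u y) → u x = φ x →
    pucciMinus lam Lam (hess φ x) + nlMinus K 1 φ x - C0 * ‖gradient φ x‖ ≤ g x

/-- Negative part `f⁻ = −min{f,0}`. -/
def nPart {d : ℕ} (f : Ed d → ℝ) : Ed d → ℝ := fun x => max (-f x) 0

/-- Positive part `f⁺ = max{f,0}`. -/
def pPart {d : ℕ} (f : Ed d → ℝ) : Ed d → ℝ := fun x => max (f x) 0

/-- The `L^p` norm of `f` on a set `S`. -/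
def LnormOn {d : ℕ} (p : ℝ) (S : Set (Ed d)) (f : Ed d → ℝ) : ℝ :=
  (∫ x in S, |f x| ^ p) ^ (1 / p)

/-- The nonlocal contact set `Γ^{n,−}_O(v)`. -/
def nContact {d : ℕ} (O : Set (Ed d)) (v : Ed d → ℝ) : Set (Ed d) :=
  {x | x ∈ O ∧ v x < sInf (v '' Oᶜ) ∧
      ∃ p : Ed d, ∀ y, Metric.infDist y O < Metric.diam O → v x + ⟪p, y - x⟫ ≤ v y}

/-- The set `G^u_M` of points where `u` is touched from below by a paraboloid of opening `M`. -/
def GSet {d : ℕ} (u : Ed d → ℝ) (M : ℝ) : Set (Ed d) :=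
  {x | ∃ ρ > 0, ∃ A C : ℝ, ∃ B : Ed d, |A| + ‖B‖ + |C| ≤ M ∧ u x = A ∧
      ∀ y ∈ Metric.ball x ρ, A + ⟪B, y - x⟫ - C / 2 * ‖y - x‖ ^ 2 ≤ u y}

/-- The bad set `B^u_M`. -/
def BSet {d : ℕ} (u : Ed d → ℝ) (M : ℝ) : Set (Ed d) := (GSet u M)ᶜ

/-- Upper semicontinuous envelope `u*`. -/
def usEnv {d : ℕ} (u : Ed d → ℝ) (x : Ed d) : ℝ :=
  ⨅ ρ : {ρ : ℝ // 0 < ρ}, ⨆ y : {y : Ed d // ‖y - x‖ ≤ ρ.1}, u y.1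

/-- Lower semicontinuous envelope `u_*`. -/
def lsEnv {d : ℕ} (u : Ed d → ℝ) (x : Ed d) : ℝ :=
  ⨆ ρ : {ρ : ℝ // 0 < ρ}, ⨅ y : {y : Ed d // ‖y - x‖ ≤ ρ.1}, u y.1

/-- A modulus of continuity. -/
def IsModulus (m : ℝ → ℝ) : Prop :=
  (∀ t, 0 ≤ m t) ∧ Monotone m ∧ m 0 = 0 ∧ ContinuousAt m 0

/-- The uniform exterior ball condition. -/
def ExtBallCond {d : ℕ} (Ω : Set (Ed d)) : Prop :=
  ∃ ρ > 0, ∀ ξ ∈ frontier Ω, ∃ y ∈ Ωᶜ, Metric.ball y ρ ⊆ Ωᶜ ∧ ξ ∈ Metric.sphere y ρ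

section HJBI

variable {d : ℕ} {𝒜 ℬ : Type}

/-- The linear nonlocal operator `I_{ab}[x, φ]`. -/
def Iop (N : 𝒜 → ℬ → Ed d → Ed d → ℝ) (a : 𝒜) (b : ℬ) (φ : Ed d → ℝ) (x : Ed d) : ℝ :=
  ∫ z, (φ (x + z) - φ x -
      (Metric.ball (0 : Ed d) 1).indicator (fun w => ⟪gradient φ x, w⟫) z) * N a b x z

/-- The HJBI operator evaluated at `φ`, with the zeroth order slot evaluated at `s`. -/
def HJBIat (aM : 𝒜 → ℬ → Ed d → Matrix (Fin d) (Fin d) ℝ) (bV : 𝒜 → ℬ → Ed d → Ed d)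
    (cF fF : 𝒜 → ℬ → Ed d → ℝ) (N : 𝒜 → ℬ → Ed d → Ed d → ℝ)
    (φ : Ed d → ℝ) (s : ℝ) (x : Ed d) : ℝ :=
  ⨆ a, ⨅ b, (-(aM a b x * hess φ x).trace - Iop N a b φ x +
    ⟪bV a b x, gradient φ x⟫ + cF a b x * s + fF a b x)

/-- The HJBI operator `ℐφ(x)`. -/
def HJBIop (aM : 𝒜 → ℬ → Ed d → Matrix (Fin d) (Fin d) ℝ) (bV : 𝒜 → ℬ → Ed d → Ed d)
    (cF fF : 𝒜 → ℬ → Ed d → ℝ) (N : 𝒜 → ℬ → Ed d → Ed d → ℝ)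
    (φ : Ed d → ℝ) (x : Ed d) : ℝ :=
  HJBIat aM bV cF fF N φ (φ x) x

/-- Viscosity subsolution of `ℐu = 0` in `Ω` (test function formulation). -/
def SubsolHJBI (aM : 𝒜 → ℬ → Ed d → Matrix (Fin d) (Fin d) ℝ) (bV : 𝒜 → ℬ → Ed d → Ed d)
    (cF fF : 𝒜 → ℬ → Ed d → ℝ) (N : 𝒜 → ℬ → Ed d → Ed d → ℝ) (Ω : Set (Ed d))
    (u : Ed d → ℝ) : Prop :=
  ∀ φ : Ed d → ℝ, ContDiff ℝ 2 φ → IsBddFun φ → ∀ x ∈ Ω, (∀ y, u y ≤ φ y) → u x = φ x →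
    HJBIop aM bV cF fF N φ x ≤ 0

/-- Viscosity supersolution of `ℐu = 0` in `Ω` (test function formulation). -/
def SupersolHJBI (aM : 𝒜 → ℬ → Ed d → Matrix (Fin d) (Fin d) ℝ) (bV : 𝒜 → ℬ → Ed d → Ed d)
    (cF fF : 𝒜 → ℬ → Ed d → ℝ) (N : 𝒜 → ℬ → Ed d → Ed d → ℝ) (Ω : Set (Ed d))
    (u : Ed d → ℝ) : Prop :=
  ∀ φ : Ed d → ℝ, ContDiff ℝ 2 φ → IsBddFun φ → ∀ x ∈ Ω, (∀ y, φ y ≤ u y) → u x = φ x →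
    0 ≤ HJBIop aM bV cF fF N φ x

/-- Uniform ellipticity of the HJBI operator `ℐ`. -/
def UnifElliptic (lam Lam C0 : ℝ) (K : Ed d → ℝ) (Ω : Set (Ed d))
    (aM : 𝒜 → ℬ → Ed d → Matrix (Fin d) (Fin d) ℝ) (bV : 𝒜 → ℬ → Ed d → Ed d)
    (cF fF : 𝒜 → ℬ → Ed d → ℝ) (N : 𝒜 → ℬ → Ed d → Ed d → ℝ) : Prop :=
  ∃ m : ℝ → ℝ, IsModulus m ∧
    ∀ r s : ℝ, ∀ x ∈ Ω, ∀ φ ψ : Ed d → ℝ,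
      ContDiff ℝ 2 φ → IsBddFun φ → ContDiff ℝ 2 ψ → IsBddFun ψ →
      (pucciMinus lam Lam (hess (fun y => φ y - ψ y) x) + nlMinus K 1 (fun y => φ y - ψ y) x -
          C0 * ‖gradient (fun y => ψ y - φ y) x‖ - m |r - s| ≤
        HJBIat aM bV cF fF N ψ r x - HJBIat aM bV cF fF N φ s x) ∧
      (HJBIat aM bV cF fF N ψ r x - HJBIat aM bV cF fF N φ s x ≤
        pucciPlus lam Lam (hess (fun y => φ y - ψ y) x) + nlPlus K 1 (fun y => φ y - ψ y) x +
          C0 * ‖gradient (fun y => ψ y - φ y) x‖ + m |r - s|)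

/-- Boundedness of the coefficient families, uniformly in `a, b`. -/
def FamiliesBdd (Ω : Set (Ed d)) (aM : 𝒜 → ℬ → Ed d → Matrix (Fin d) (Fin d) ℝ)
    (bV : 𝒜 → ℬ → Ed d → Ed d) (cF fF : 𝒜 → ℬ → Ed d → ℝ) : Prop :=
  ∃ Cb : ℝ, ∀ a b, ∀ x ∈ Ω, (∀ i j, |aM a b x i j| ≤ Cb) ∧ ‖bV a b x‖ ≤ Cb ∧
      |cF a b x| ≤ Cb ∧ |fF a b x| ≤ Cb

/-- Uniform continuity of the coefficient families with a common modulus, uniformly in `a, b, z`. -/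
def FamiliesUC (Ω : Set (Ed d)) (aM : 𝒜 → ℬ → Ed d → Matrix (Fin d) (Fin d) ℝ)
    (bV : 𝒜 → ℬ → Ed d → Ed d) (cF fF : 𝒜 → ℬ → Ed d → ℝ)
    (N : 𝒜 → ℬ → Ed d → Ed d → ℝ) : Prop :=
  ∃ m₀ : ℝ → ℝ, IsModulus m₀ ∧ ∀ a b, ∀ x ∈ Ω, ∀ y ∈ Ω,
      (∀ i j, |aM a b x i j - aM a b y i j| ≤ m₀ ‖x - y‖) ∧
      ‖bV a b x - bV a b y‖ ≤ m₀ ‖x - y‖ ∧ |cF a b x - cF a b y| ≤ m₀ ‖x - y‖ ∧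
      |fF a b x - fF a b y| ≤ m₀ ‖x - y‖ ∧ ∀ z, |N a b x z - N a b y z| ≤ m₀ ‖x - y‖

end HJBI

/-! ### Trace and Pucci bounds -/

lemma ell_nonempty {d : ℕ} {lam Lam : ℝ} (h : lam ≤ Lam) : (ellipticSet lam Lam d).Nonempty := by
  refine ⟨lam • (1 : Matrix (Fin d) (Fin d) ℝ), ?_, ?_, ?_⟩
  · simp [Matrix.IsSymm]
  · simpa using Matrix.PosSemidef.zero
  · rw [← sub_smul]
    exact Matrix.PosSemidef.one.smul (by linarith)

lemma ell_quad {d : ℕ} {lam Lam : ℝ} {A : Matrix (Fin d) (Fin d) ℝ}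
    (hA : A ∈ ellipticSet lam Lam d) (v : Ed d) :
    lam * ‖v‖ ^ 2 ≤ (A * Matrix.vecMulVec (fun i => v i) (fun i => v i)).trace := by
  have h := hA.2.1.dotProduct_mulVec_nonneg (fun i => v i)
  rw [Matrix.mul_vecMulVec, Matrix.trace_vecMulVec]
  rw [Matrix.sub_mulVec, dotProduct_sub, Matrix.smul_mulVec, Matrix.one_mulVec] at h
  rw [EuclideanSpace.real_norm_sq_eq]
  have e1 : star (fun i => v i) = (fun i => v i) := by ext i; simp
  rw [e1] at h
  rw [dotProduct_comm]
  simp only [dotProduct_smul, smul_eq_mul] at h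
  have : ((fun i => v i) ⬝ᵥ (fun i => v i) : ℝ) = ∑ i, v i ^ 2 := by
    simp [dotProduct, sq]
  rw [this] at h
  linarith

lemma ell_trace {d : ℕ} {lam Lam : ℝ} {A : Matrix (Fin d) (Fin d) ℝ}
    (hA : A ∈ ellipticSet lam Lam d) : A.trace ≤ d * Lam := by
  have h := hA.2.2.trace_nonneg
  simp at h
  linarith

lemma pucci_lower {d : ℕ} {lam Lam : ℝ} (hL : lam ≤ Lam) (α β γ : ℝ) (hα : 0 ≤ α) (hβ : 0 ≤ β)
    (hγ : 0 ≤ γ) (v e : Ed d) (X : Matrix (Fin d) (Fin d) ℝ)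
    (hX : ∀ i j, X i j = -α * (if i = j then 1 else 0) + β * (v i * v j) + γ * (e i * e j)) :
    -α * (d * Lam) + β * (lam * ‖v‖ ^ 2) + γ * (lam * ‖e‖ ^ 2) ≤ pucciMinus lam Lam X := by
  have hX' : X = (-α) • (1 : Matrix (Fin d) (Fin d) ℝ)
      + β • Matrix.vecMulVec (fun i => v i) (fun i => v i)
      + γ • Matrix.vecMulVec (fun i => e i) (fun i => e i) := by
    ext i j
    rw [hX]
    simp only [Matrix.add_apply, Matrix.smul_apply, Matrix.one_apply, Matrix.vecMulVec_apply,
      smul_eq_mul]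
  refine le_csInf ((ell_nonempty hL).image _) ?_
  rintro _ ⟨A, hA, rfl⟩
  have h1 := ell_quad hA v
  have h2 := ell_quad hA e
  have h3 := ell_trace hA
  simp only [hX', mul_add, Matrix.mul_smul, Matrix.trace_add, Matrix.trace_smul, smul_eq_mul,
    mul_one]
  have := mul_le_mul_of_nonneg_left h1 hβ
  have := mul_le_mul_of_nonneg_left h2 hγ
  have := mul_le_mul_of_nonneg_left h3 hα
  linarith

/-! ### The test lemma -/

/-- The Lévy mass of the kernel. -/
def IK {d : ℕ} (K : Ed d → ℝ) : ℝ := ∫ z : Ed d, min (‖z‖ ^ 2) 1 * K z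

lemma IK_nonneg {d : ℕ} {K : Ed d → ℝ} (hK : KernCond K) : 0 ≤ IK K :=
  integral_nonneg fun z => mul_nonneg (le_min (by positivity) zero_le_one) (hK.2.1 z)

/-- A smooth truncation from below. -/
def thet (a t : ℝ) : ℝ := t * Real.smoothTransition (t / a + 2)

lemma thet_le {a : ℝ} (t : ℝ) : thet a t ≤ max t 0 := by
  unfold thet
  have h0 := Real.smoothTransition.nonneg (t / a + 2)
  have h1 := Real.smoothTransition.le_one (t / a + 2)
  rcases le_total t 0 with h | h
  · rw [max_eq_right h]; nlinarith
  · rw [max_eq_left h]; nlinarith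

lemma le_thet {a : ℝ} (ha : 0 < a) (t : ℝ) : t ≤ thet a t := by
  unfold thet
  have h0 := Real.smoothTransition.nonneg (t / a + 2)
  have h1 := Real.smoothTransition.le_one (t / a + 2)
  rcases le_total t 0 with h | h
  · nlinarith
  · rw [Real.smoothTransition.one_of_one_le]; · simp
    have : 0 ≤ t / a := by positivity
    linarith

lemma thet_ge {a : ℝ} (ha : 0 < a) (t : ℝ) : -(2 * a) ≤ thet a t := by
  unfold thet
  rcases le_total (t / a + 2) 0 with h | h
  · rw [Real.smoothTransition.zero_of_nonpos h]; simp; linarith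
  · refine le_trans ?_ (le_thet ha t)
    have : -2 ≤ t / a := by linarith
    rw [le_div_iff₀ ha] at this
    linarith

lemma thet_eq {a : ℝ} (ha : 0 < a) {t : ℝ} (h : -a ≤ t) : thet a t = t := by
  unfold thet
  rw [Real.smoothTransition.one_of_one_le]; · simp
  have : -1 ≤ t / a := by rw [le_div_iff₀ ha]; linarith
  linarith

lemma contDiff_thet (a : ℝ) : ContDiff ℝ 2 (thet a) := by
  unfold thet
  refine contDiff_id.mul (Real.smoothTransition.contDiff.comp ?_)
  fun_prop

lemma kern_integral {d : ℕ} {K : Ed d → ℝ} (hK : KernCond K) {r : ℝ} (hr : 0 < r) (hr1 : r ≤ 1)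
    (g : Ed d → ℝ) (hg0 : ∀ z, 0 ≤ g z) (B : ℝ) (hB : 0 ≤ B)
    (hg1 : ∀ z, ‖z‖ < 1 / r → g z ≤ B * ‖z‖ ^ 2) (hg2 : ∀ z, 1 / r ≤ ‖z‖ → g z ≤ B) :
    ∫ z, g z * Kresc K r z ≤ B * IK K := by
  have hJ : Integrable (fun z : Ed d => r ^ d * (min (‖r • z‖ ^ 2) 1 * K (r • z))) :=
    (hK.2.2.comp_smul hr.ne').const_mul _
  have hJ2 : ∫ z : Ed d, r ^ d * (min (‖r • z‖ ^ 2) 1 * K (r • z)) = IK K := by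
    rw [integral_const_mul, Measure.integral_comp_smul_of_nonneg (volume : Measure (Ed d))
      (fun z : Ed d => min (‖z‖ ^ 2) 1 * K z) r (hR := hr.le)]
    simp only [finrank_euclideanSpace, Fintype.card_fin, smul_eq_mul, IK]
    rw [← mul_assoc, mul_inv_cancel₀ (by positivity), one_mul]
  rw [← hJ2, ← integral_const_mul]
  refine integral_mono_of_nonneg (Filter.Eventually.of_forall fun z => ?_) (hJ.const_mul B)
    (Filter.Eventually.of_forall fun z => ?_)
  · exact mul_nonneg (hg0 z) (mul_nonneg (by positivity) (hK.2.1 _))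
  · have hk := hK.2.1 (r • z)
    have key : g z * r ^ 2 ≤ B * min (‖r • z‖ ^ 2) 1 := by
      rw [norm_smul, Real.norm_of_nonneg hr.le, mul_pow]
      rcases lt_or_ge ‖z‖ (1 / r) with h | h
      · have h' : r * ‖z‖ < 1 := by rwa [lt_div_iff₀ hr, mul_comm] at h
        rw [min_eq_left]
        · nlinarith [hg1 z h, sq_nonneg r]
        · have : 0 ≤ r * ‖z‖ := by positivity
          nlinarith
      · have h' : 1 ≤ r * ‖z‖ := by rwa [div_le_iff₀ hr, mul_comm] at h
        rw [min_eq_right]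
        · have := mul_le_mul (hg2 z h) (pow_le_one₀ hr.le hr1 (n := 2)) (by positivity) hB
          linarith
        · nlinarith
    simp only [Kresc]
    have : g z * (r ^ (d + 2) * K (r • z)) = (g z * r ^ 2) * (r ^ d * K (r • z)) := by ring
    rw [this]
    calc _ ≤ (B * min (‖r • z‖ ^ 2) 1) * (r ^ d * K (r • z)) :=
          mul_le_mul_of_nonneg_right key (by positivity)
      _ = _ := by ring

lemma test_ineq {d : ℕ} {lam Lam C0 r : ℝ} {K f u : Ed d → ℝ} {O : Set (Ed d)}
    (hK : KernCond K) (hr : 0 < r) (hr1 : r ≤ 1) (hu0 : ∀ x, 0 ≤ u x) (hub : IsBddFun u)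
    (hsup : SupersolExtremal lam Lam C0 r K f O u) {x : Ed d} (hx : x ∈ O) {φ : Ed d → ℝ}
    (hφ : ContDiff ℝ 2 φ) (hφu : ∀ y, φ y ≤ u y) (hux : u x = φ x) {B : ℝ} (hB : 0 ≤ B)
    (hsc : ∀ h, φ x + ⟪gradient φ x, h⟫ - B * ‖h‖ ^ 2 ≤ φ (x + h)) :
    f x ≤ -pucciMinus lam Lam (hess φ x) + (B + φ x) * IK K + C0 * r * ‖gradient φ x‖ := by
  have hI := IK_nonneg hK
  have hφx : 0 ≤ φ x := hux ▸ hu0 x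
  have main : ∀ a : ℝ, 0 < a →
      f x ≤ -pucciMinus lam Lam (hess φ x) + (B + (φ x + 2 * a)) * IK K
        + C0 * r * ‖gradient φ x‖ := by
    intro a ha
    obtain ⟨M, hM⟩ := hub
    have hev : (fun y => thet a (φ y)) =ᶠ[nhds x] φ := by
      have : ∀ᶠ y in nhds x, -a < φ y :=
        hφ.continuous.continuousAt.eventually (lt_mem_nhds (by linarith))
      filter_upwards [this] with y hy
      exact thet_eq ha hy.le
    have hgrad : gradient (fun y => thet a (φ y)) x = gradient φ x := by
      unfold gradient
      rw [hev.fderiv_eq]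
    have hhess : hess (fun y => thet a (φ y)) x = hess φ x := by
      unfold hess
      rw [(Filter.EventuallyEq.iteratedFDeriv ℝ hev 2).eq_of_nhds]
    have hval : thet a (φ x) = φ x := hev.eq_of_nhds
    have h := hsup (fun y => thet a (φ y)) ((contDiff_thet a).comp hφ)
      ⟨M + 2 * a, fun y => by
        have h1 := thet_ge ha (φ y)
        have h2 := thet_le (a := a) (φ y)
        have h3 := hM y
        have h4 := hu0 y
        have h5 : max (φ y) 0 ≤ M := max_le ((hφu y).trans ((le_abs_self _).trans h3))
          ((hu0 y).trans ((le_abs_self _).trans h3))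
        rw [abs_le]
        constructor <;> linarith [h4.trans ((le_abs_self _).trans h3)]⟩ x hx
      (fun y => (thet_le _).trans (max_le (hφu y) (hu0 y))) (by rw [hval, hux])
    rw [hgrad, hhess] at h
    refine h.trans ?_
    have : -nlMinus K r (fun y => thet a (φ y)) x ≤ (B + (φ x + 2 * a)) * IK K := by
      unfold nlMinus
      rw [neg_neg]
      refine kern_integral hK hr hr1 _ (fun z => le_max_right _ _) _ (by linarith) ?_ ?_
      · intro z hz
        refine max_le ?_ (by positivity)
        unfold deltaOp
        rw [indicator_of_mem (by simpa using hz), hgrad]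
        simp only [hval]
        have := hsc z
        have := le_thet ha (φ (x + z))
        have : 0 ≤ (φ x + 2 * a) * ‖z‖ ^ 2 := by positivity
        nlinarith
      · intro z hz
        refine max_le ?_ (by positivity)
        unfold deltaOp
        rw [indicator_of_notMem (by simpa using hz)]
        simp only [hval]
        have := thet_ge ha (φ (x + z))
        linarith
    linarith
  refine le_of_forall_pos_le_add fun ε hε => ?_
  have := main (ε / (2 * (IK K + 1))) (by positivity)
  refine this.trans ?_
  have h2 : 2 * (ε / (2 * (IK K + 1))) * IK K ≤ ε := by
    have : 2 * (ε / (2 * (IK K + 1))) * IK K = ε * (IK K / (IK K + 1)) := by field_simp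
    rw [this]
    have : IK K / (IK K + 1) ≤ 1 := by rw [div_le_one (by positivity)]; linarith
    nlinarith
  nlinarith

/-! ### The explicit test functions -/

/-- The convex profile. -/
def GG (s : ℝ) : ℝ := Real.sqrt (1 + s ^ 2) / 4 + s / 2 - 1 / 8

def GG1 (s : ℝ) : ℝ := s / (4 * Real.sqrt (1 + s ^ 2)) + 1 / 2

def GG2 (s : ℝ) : ℝ := 1 / (4 * ((1 + s ^ 2) * Real.sqrt (1 + s ^ 2)))

lemma sqrt_one_sq_pos (s : ℝ) : 0 < Real.sqrt (1 + s ^ 2) := Real.sqrt_pos.2 (by positivity)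

lemma hasDerivAt_GG (s : ℝ) : HasDerivAt GG (GG1 s) s := by
  have h1 : HasDerivAt (fun s : ℝ => 1 + s ^ 2) (2 * s) s := by
    simpa using (hasDerivAt_pow 2 s).const_add 1
  have h2 := (((h1.sqrt (by positivity)).div_const 4).add ((hasDerivAt_id s).div_const 2)).sub_const
    (1 / 8)
  refine h2.congr_deriv ?_
  have := sqrt_one_sq_pos s
  unfold GG1
  field_simp

lemma hasDerivAt_GG1 (s : ℝ) : HasDerivAt GG1 (GG2 s) s := by
  have h1 : HasDerivAt (fun s : ℝ => 1 + s ^ 2) (2 * s) s := by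
    simpa using (hasDerivAt_pow 2 s).const_add 1
  have hp := sqrt_one_sq_pos s
  have h2 := ((hasDerivAt_id s).div ((h1.sqrt (by positivity)).const_mul 4)
    (by positivity)).add_const (1 / 2)
  refine h2.congr_deriv ?_
  unfold GG2
  have hq : Real.sqrt (1 + s ^ 2) ^ 2 = 1 + s ^ 2 := Real.sq_sqrt (by positivity)
  simp only [id]
  field_simp
  rw [hq]
  ring

lemma contDiff_GG : ContDiff ℝ 2 GG := by
  unfold GG
  have : ContDiff ℝ 2 (fun s : ℝ => Real.sqrt (1 + s ^ 2)) :=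
    ContDiff.sqrt (by fun_prop) (fun s => by positivity)
  fun_prop

lemma GG_convex (s t : ℝ) : GG s + GG1 s * (t - s) ≤ GG t := by
  have hs := sqrt_one_sq_pos s
  have hcs : 1 + s * t ≤ Real.sqrt (1 + s ^ 2) * Real.sqrt (1 + t ^ 2) := by
    rw [← Real.sqrt_mul (by positivity)]
    refine Real.le_sqrt_of_sq_le ?_
    nlinarith [sq_nonneg (s - t)]
  have hq : Real.sqrt (1 + s ^ 2) ^ 2 = 1 + s ^ 2 := Real.sq_sqrt (by positivity)
  have key : Real.sqrt (1 + s ^ 2) + s / Real.sqrt (1 + s ^ 2) * (t - s) ≤ Real.sqrt (1 + t ^ 2) := by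
    have : Real.sqrt (1 + s ^ 2) + s / Real.sqrt (1 + s ^ 2) * (t - s)
        = (1 + s * t) / Real.sqrt (1 + s ^ 2) := by
      field_simp
      rw [hq]; ring
    rw [this, div_le_iff₀ hs]
    linarith
  unfold GG GG1
  have : s / (4 * Real.sqrt (1 + s ^ 2)) = s / Real.sqrt (1 + s ^ 2) / 4 := by
    field_simp
  rw [this]
  linarith

lemma GG_zero : GG 0 = 1 / 8 := by unfold GG; norm_num

lemma sqrt_le_abs (s : ℝ) : Real.sqrt (1 + s ^ 2) ≤ 1 + |s| := by
  rw [Real.sqrt_le_left (by positivity)]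
  nlinarith [sq_abs s, abs_nonneg s]

lemma GG_le_one (s : ℝ) : GG s - max (s - 1) 0 ≤ 1 := by
  have h := sqrt_le_abs s
  have h1 := le_max_left (s - 1) 0
  have h2 := le_max_right (s - 1) 0
  unfold GG
  rcases abs_cases s with ⟨e, _⟩ | ⟨e, _⟩ <;> rw [e] at h <;> linarith

lemma GG_range {s : ℝ} (hs : max (s - 1) 0 < GG s) : |s| ≤ 5 := by
  have h := sqrt_le_abs s
  have h1 := (le_max_left (s - 1) 0).trans_lt hs
  have h2 := (le_max_right (s - 1) 0).trans_lt hs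
  unfold GG at h1 h2
  rcases abs_cases s with ⟨e, _⟩ | ⟨e, _⟩ <;> rw [e] at h ⊢ <;> linarith

lemma GG_le_four {s : ℝ} (hs : |s| ≤ 5) : GG s ≤ 4 := by
  have h := sqrt_le_abs s
  unfold GG
  have := le_abs_self s
  linarith

lemma GG1_abs (s : ℝ) : |GG1 s| ≤ 1 := by
  have hs := sqrt_one_sq_pos s
  have h1 : |s| ≤ Real.sqrt (1 + s ^ 2) := Real.abs_le_sqrt (by linarith)
  have h2 : |s / (4 * Real.sqrt (1 + s ^ 2))| ≤ 1 / 4 := by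
    rw [abs_div, abs_of_pos (by positivity : 0 < 4 * Real.sqrt (1 + s ^ 2)), div_le_iff₀ (by positivity)]
    linarith
  unfold GG1
  rw [abs_le] at *
  constructor <;> linarith

lemma GG2_nonneg (s : ℝ) : 0 ≤ GG2 s := by unfold GG2; positivity

lemma GG2_ge {s : ℝ} (hs : |s| ≤ 5) : 1 / 624 ≤ GG2 s := by
  have h : Real.sqrt (1 + s ^ 2) ≤ 6 := (sqrt_le_abs s).trans (by linarith)
  have h2 : 1 + s ^ 2 ≤ 26 := by nlinarith [sq_abs s, abs_nonneg s]
  have := sqrt_one_sq_pos s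
  unfold GG2
  refine one_div_le_one_div_of_le (by positivity) ?_
  have := mul_le_mul h2 h this.le (by norm_num)
  linarith

section Testfun
variable {d : ℕ}

/-- The test function. -/
def tf (c a q k κ τ δ : ℝ) (y0 y x' x0 e z : Ed d) : ℝ :=
  c - a / 2 * ‖z - y0‖ ^ 2 - a / 2 * ‖z - y‖ ^ 2 + q * Real.exp (-(k * ‖z - x'‖ ^ 2))
    + κ * τ ^ 2 * GG (⟪e, z - x0⟫ / τ) - κ * δ * ‖z - x0‖ ^ 2

/-- Its gradient. -/
def tg (a q k κ τ δ : ℝ) (y0 y x' x0 e z : Ed d) : Ed d :=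
  -(a • (z - y0)) - a • (z - y) - (2 * k * q) • (Real.exp (-(k * ‖z - x'‖ ^ 2)) • (z - x'))
    + (κ * τ) • (GG1 (⟪e, z - x0⟫ / τ) • e) - (2 * κ * δ) • (z - x0)

lemma contDiff_tf (c a q k κ τ δ : ℝ) (y0 y x' x0 e : Ed d) :
    ContDiff ℝ 2 (tf c a q k κ τ δ y0 y x' x0 e) := by
  unfold tf
  have hn : ∀ w : Ed d, ContDiff ℝ 2 (fun z : Ed d => ‖z - w‖ ^ 2) := fun w =>
    ContDiff.norm_sq ℝ (by fun_prop)
  have h1 : ContDiff ℝ 2 (fun z : Ed d => Real.exp (-(k * ‖z - x'‖ ^ 2))) :=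
    Real.contDiff_exp.comp ((contDiff_const.mul (hn x')).neg)
  have h2 : ContDiff ℝ 2 (fun z : Ed d => GG (⟪e, z - x0⟫ / τ)) :=
    contDiff_GG.comp ((ContDiff.inner ℝ contDiff_const (by fun_prop)).div_const _)
  exact (((((contDiff_const.sub (contDiff_const.mul (hn y0))).sub (contDiff_const.mul (hn y))).add
    (contDiff_const.mul h1)).add (contDiff_const.mul h2)).sub (contDiff_const.mul (hn x0)))

lemma hasFDerivAt_nsq (w z : Ed d) :
    HasFDerivAt (fun z : Ed d => ‖z - w‖ ^ 2) ((2 : ℝ) • (innerSL ℝ (z - w))) z := by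
  have := ((hasFDerivAt_id z).sub_const w).norm_sq
  refine this.congr_fderiv ?_
  ext v
  simp

lemma hasFDerivAt_expn (k : ℝ) (w z : Ed d) :
    HasFDerivAt (fun z : Ed d => Real.exp (-(k * ‖z - w‖ ^ 2)))
      (Real.exp (-(k * ‖z - w‖ ^ 2)) • (-(k • ((2 : ℝ) • (innerSL ℝ (z - w)))))) z :=
  (((hasFDerivAt_nsq w z).const_mul k).neg).exp

lemma hasFDerivAt_lin (τ : ℝ) (e x0 z : Ed d) :
    HasFDerivAt (fun z : Ed d => ⟪e, z - x0⟫ / τ) (τ⁻¹ • innerSL ℝ e) z := by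
  have h : HasFDerivAt (fun z : Ed d => ⟪e, z - x0⟫) (innerSL ℝ e) z := by
    have := ((innerSL ℝ e).hasFDerivAt (x := z - x0)).comp z ((hasFDerivAt_id z).sub_const x0)
    exact this
  have := h.mul_const τ⁻¹
  simpa [div_eq_mul_inv] using this

lemma hasFDerivAt_tf (c a q k κ δ : ℝ) {τ : ℝ} (hτ : 0 < τ) (y0 y x' x0 e z : Ed d) :
    HasFDerivAt (tf c a q k κ τ δ y0 y x' x0 e)
      (innerSL ℝ (tg a q k κ τ δ y0 y x' x0 e z)) z := by
  have h1 := (hasFDerivAt_nsq y0 z).const_mul (a / 2)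
  have h2 := (hasFDerivAt_nsq y z).const_mul (a / 2)
  have h3 := (hasFDerivAt_expn k x' z).const_mul q
  have h4 := ((hasDerivAt_GG (⟪e, z - x0⟫ / τ)).comp_hasFDerivAt z
    (hasFDerivAt_lin τ e x0 z)).const_mul (κ * τ ^ 2)
  have h5 := (hasFDerivAt_nsq x0 z).const_mul (κ * δ)
  have := (((((hasFDerivAt_const c z).sub h1).sub h2).add h3).add h4).sub h5
  refine this.congr_fderiv ?_
  ext v
  simp [tg]
  field_simp
  ring

lemma gradient_tf (c a q k κ δ : ℝ) {τ : ℝ} (hτ : 0 < τ) (y0 y x' x0 e z : Ed d) :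
    gradient (tf c a q k κ τ δ y0 y x' x0 e) z = tg a q k κ τ δ y0 y x' x0 e z := by
  refine HasGradientAt.gradient ?_
  rw [hasGradientAt_iff_hasFDerivAt]
  exact hasFDerivAt_tf c a q k κ δ hτ y0 y x' x0 e z

lemma tf_semiconvex (c a k : ℝ) {q κ δ τ : ℝ} (hq : 0 ≤ q) (hκ : 0 ≤ κ)
    (hτ : 0 < τ) (y0 y x' x0 e x h : Ed d) :
    tf c a q k κ τ δ y0 y x' x0 e x + ⟪tg a q k κ τ δ y0 y x' x0 e x, h⟫
      - (a + q * k * Real.exp (-(k * ‖x - x'‖ ^ 2)) + κ * δ) * ‖h‖ ^ 2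
      ≤ tf c a q k κ τ δ y0 y x' x0 e (x + h) := by
  have hn : ∀ w : Ed d, ‖x + h - w‖ ^ 2 = ‖x - w‖ ^ 2 + 2 * ⟪x - w, h⟫ + ‖h‖ ^ 2 := by
    intro w
    rw [show x + h - w = (x - w) + h by abel, norm_add_sq_real]
  have hexp : Real.exp (-(k * ‖x - x'‖ ^ 2)) * (1 - 2 * k * ⟪x - x', h⟫ - k * ‖h‖ ^ 2)
      ≤ Real.exp (-(k * ‖x + h - x'‖ ^ 2)) := by
    rw [hn x', show -(k * (‖x - x'‖ ^ 2 + 2 * ⟪x - x', h⟫ + ‖h‖ ^ 2))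
      = -(k * ‖x - x'‖ ^ 2) + (-2 * k * ⟪x - x', h⟫ - k * ‖h‖ ^ 2) by ring, Real.exp_add]
    refine mul_le_mul_of_nonneg_left ?_ (Real.exp_pos _).le
    have := Real.add_one_le_exp (-2 * k * ⟪x - x', h⟫ - k * ‖h‖ ^ 2)
    linarith
  have hG := GG_convex (⟪e, x - x0⟫ / τ) (⟪e, x + h - x0⟫ / τ)
  have hlin : ⟪e, x + h - x0⟫ / τ - ⟪e, x - x0⟫ / τ = ⟪e, h⟫ / τ := by
    rw [show x + h - x0 = (x - x0) + h by abel, inner_add_right]; ring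
  rw [hlin] at hG
  have h1 := mul_le_mul_of_nonneg_left hexp hq
  have h2 := mul_le_mul_of_nonneg_left hG (by positivity : 0 ≤ κ * τ ^ 2)
  have h3 : κ * τ ^ 2 * (GG1 (⟪e, x - x0⟫ / τ) * (⟪e, h⟫ / τ))
      = κ * τ * (GG1 (⟪e, x - x0⟫ / τ) * ⟪e, h⟫) := by field_simp
  unfold tf
  rw [hn y0, hn y, hn x0]
  simp only [tg, inner_sub_left, inner_add_left, inner_smul_left, inner_neg_left,
    RCLike.conj_to_real] at *
  rw [mul_add, h3] at h2
  linarith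

lemma hess_tf (c a q k κ δ : ℝ) {τ : ℝ} (hτ : 0 < τ) (y0 y x' x0 e z : Ed d) (i j : Fin d) :
    hess (tf c a q k κ τ δ y0 y x' x0 e) z i j =
      -(2 * a + 2 * k * q * Real.exp (-(k * ‖z - x'‖ ^ 2)) + 2 * κ * δ) * (if i = j then 1 else 0)
      + 4 * k ^ 2 * q * Real.exp (-(k * ‖z - x'‖ ^ 2)) * ((z - x') i * (z - x') j)
      + κ * GG2 (⟪e, z - x0⟫ / τ) * (e i * e j) := by
  set φ := tf c a q k κ τ δ y0 y x' x0 e with hφ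
  have hf : fderiv ℝ φ = fun z => innerSL ℝ (tg a q k κ τ δ y0 y x' x0 e z) :=
    funext fun z => (hasFDerivAt_tf c a q k κ δ hτ y0 y x' x0 e z).fderiv
  have hdiff : DifferentiableAt ℝ (fderiv ℝ φ) z :=
    ((contDiff_tf c a q k κ τ δ y0 y x' x0 e).fderiv_right (m := 1) (by norm_num)).differentiable
      (by norm_num) z
  unfold hess
  rw [Matrix.of_apply, iteratedFDeriv_two_apply]
  simp only [Matrix.cons_val_zero, Matrix.cons_val_one]
  set v := EuclideanSpace.single i (1 : ℝ) with hv
  set w := EuclideanSpace.single j (1 : ℝ) with hw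
  have e1 : fderiv ℝ (fun z => fderiv ℝ φ z w) z v = fderiv ℝ (fderiv ℝ φ) z v w := by
    rw [fderiv_clm_apply hdiff (differentiableAt_const w)]
    simp
  rw [← e1]
  have e2 : (fun z => fderiv ℝ φ z w) = fun z : Ed d => -(a * ⟪w, z - y0⟫) - a * ⟪w, z - y⟫
      - (2 * k * q) * (Real.exp (-(k * ‖z - x'‖ ^ 2)) * ⟪w, z - x'⟫)
      + (κ * τ) * (GG1 (⟪e, z - x0⟫ / τ) * ⟪w, e⟫) - (2 * κ * δ) * ⟪w, z - x0⟫ := by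
    funext z
    rw [hf]
    simp only [innerSL_apply_apply]
    rw [real_inner_comm]
    simp only [tg, inner_sub_right, inner_add_right, inner_smul_right, inner_neg_right]
  rw [e2]
  have hl : ∀ y : Ed d, HasFDerivAt (fun z : Ed d => ⟪w, z - y⟫) (innerSL ℝ w) z := by
    intro y
    have := hasFDerivAt_lin 1 w y z
    simpa using this
  have h3 := ((hasFDerivAt_expn k x' z).mul (hl x')).const_mul (2 * k * q)
  have h4 := (((hasDerivAt_GG1 (⟪e, z - x0⟫ / τ)).comp_hasFDerivAt z
    (hasFDerivAt_lin τ e x0 z)).mul_const ⟪w, e⟫).const_mul (κ * τ)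
  have := ((((((hl y0).const_mul a).neg).sub ((hl y).const_mul a)).sub h3).add h4).sub
    ((hl x0).const_mul (2 * κ * δ))
  have e3 := HasFDerivAt.fderiv this
  refine (congrArg (fun L => L v) e3).trans ?_
  have hwv : ⟪w, v⟫ = if i = j then (1 : ℝ) else 0 := by
    rw [hw, hv]; simp [EuclideanSpace.inner_single_left, Pi.single_apply, eq_comm]
  have hxw : ⟪w, z - x'⟫ = (z - x') j := by rw [hw]; simp [EuclideanSpace.inner_single_left]
  have hew : ⟪w, e⟫ = e j := by rw [hw]; simp [EuclideanSpace.inner_single_left]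
  have hev : ⟪e, v⟫ = e i := by rw [hv]; simp [EuclideanSpace.inner_single_right]
  have hxv : ⟪z - x', v⟫ = (z - x') i := by rw [hv]; simp [EuclideanSpace.inner_single_right]
  simp only [sub_apply, add_apply,
    neg_apply, smul_apply, smul_eq_mul,
    innerSL_apply_apply, hwv, hxw, hew, hev, hxv]
  field_simp
  ring

end Testfun

section Pair
variable {d : ℕ}

lemma exists_global_min {w : Ed d → ℝ} (hw : LowerSemicontinuous w) {x0 p : Ed d} {R : ℝ}
    (hp : p ∈ closedBall x0 R) (hout : ∀ z, z ∉ closedBall x0 R → w p ≤ w z) :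
    ∃ x ∈ closedBall x0 R, ∀ z, w x ≤ w z := by
  obtain ⟨x, hx, hmin⟩ := LowerSemicontinuousOn.exists_isMinOn ⟨p, hp⟩
    (isCompact_closedBall x0 R) (hw.lowerSemicontinuousOn _)
  refine ⟨x, hx, fun z => ?_⟩
  by_cases hz : z ∈ closedBall x0 R
  · exact hmin hz
  · exact (hmin hp).trans (hout z hz)

/-- The objective function whose minimizers are the contact points. -/
def ob (u : Ed d → ℝ) (a q k : ℝ) (y0 x' y z : Ed d) : ℝ :=
  u z + a / 2 * ‖z - y0‖ ^ 2 + a / 2 * ‖z - y‖ ^ 2 - q * Real.exp (-(k * ‖z - x'‖ ^ 2))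

lemma ob_lsc {u : Ed d → ℝ} (hu : LowerSemicontinuous u) (a q k : ℝ) (y0 x' y : Ed d) :
    LowerSemicontinuous (ob u a q k y0 x' y) := by
  have : Continuous (fun z : Ed d => a / 2 * ‖z - y0‖ ^ 2 + a / 2 * ‖z - y‖ ^ 2
    - q * Real.exp (-(k * ‖z - x'‖ ^ 2))) := by fun_prop
  have h := hu.add this.lowerSemicontinuous
  refine (congrArg LowerSemicontinuous ?_).mp h
  funext z
  simp only [ob]
  ring

lemma norm_tg_le {a q k κ τ δ : ℝ} (ha : 0 ≤ a) (hq : 0 ≤ q) (hk : 0 ≤ k) (hκ : 0 ≤ κ)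
    (hτ : 0 ≤ τ) (hδ : 0 ≤ δ) (y0 y x' x0 e z : Ed d) (he : ‖e‖ = 1) :
    ‖tg a q k κ τ δ y0 y x' x0 e z‖ ≤ a * ‖z - y0‖ + a * ‖z - y‖
      + 2 * k * q * Real.exp (-(k * ‖z - x'‖ ^ 2)) * ‖z - x'‖ + κ * τ + 2 * κ * δ * ‖z - x0‖ := by
  unfold tg
  refine (norm_sub_le _ _).trans ?_
  refine add_le_add ((norm_add_le _ _).trans (add_le_add ((norm_sub_le _ _).trans
    (add_le_add ((norm_sub_le _ _).trans (add_le_add ?_ ?_)) ?_)) ?_)) ?_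
  · rw [norm_neg, norm_smul, Real.norm_of_nonneg ha]
  · rw [norm_smul, Real.norm_of_nonneg ha]
  · rw [norm_smul, norm_smul, Real.norm_of_nonneg (by positivity),
      Real.norm_of_nonneg (Real.exp_pos _).le]
    exact le_of_eq (by ring)
  · rw [norm_smul, norm_smul, Real.norm_of_nonneg (by positivity), he, mul_one, Real.norm_eq_abs]
    have := GG1_abs (⟪e, z - x0⟫ / τ)
    have : 0 ≤ κ * τ := by positivity
    nlinarith
  · rw [norm_smul, Real.norm_of_nonneg (by positivity)]

set_option maxHeartbeats 1000000 in
lemma touch_ineq {lam Lam C0 r : ℝ} {K f u : Ed d → ℝ} {O : Set (Ed d)} (hlam : 0 < lam)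
    (hL : lam ≤ Lam) (hC0 : 0 ≤ C0)
    (hK : KernCond K) (hr : 0 < r) (hr1 : r ≤ 1)
    (hu0 : ∀ x, 0 ≤ u x) (hub : IsBddFun u)
    (hsup : SupersolExtremal lam Lam C0 r K f O u)
    {a q k δ τ κ cc c E : ℝ} (ha : 0 < a) (hq : 0 ≤ q) (hk : 0 ≤ k) (hδ : 0 < δ) (hτ : 0 < τ)
    (hκ : 0 < κ) {y0 x' y x0 x2 e : Ed d} (he : ‖e‖ = 1)
    (hφu : ∀ z, tf cc a q k κ τ δ y0 y x' x0 e z ≤ u z)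
    (hux : u x2 = tf cc a q k κ τ δ y0 y x' x0 e x2) (hcc : cc ≤ c) (hx2 : x2 ∈ O)
    (hx2n : δ * ‖x2 - x0‖ ≤ τ) (hs : |⟪e, x2 - x0⟫ / τ| ≤ 5)
    (hEdef : E = Real.exp (-(k * ‖x2 - x'‖ ^ 2))) :
      f x2 ≤ (2 * a + 2 * k * q * E + 2 * κ * δ) * (d * Lam)
        - 4 * k ^ 2 * q * E * (lam * ‖x2 - x'‖ ^ 2) - κ * lam / 624
        + (a + q * k * E + κ * δ + (c + q * E + 4 * κ * τ ^ 2)) * IK K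
        + C0 * (a * ‖x2 - y0‖ + a * ‖x2 - y‖ + 2 * k * q * E * ‖x2 - x'‖ + 3 * κ * τ) := by
  have hI := IK_nonneg hK
  have hE : 0 < E := by rw [hEdef]; exact Real.exp_pos _
  have hgrad := gradient_tf cc a q k κ δ hτ y0 y x' x0 e x2
  have htest := test_ineq hK hr hr1 hu0 hub hsup hx2 (contDiff_tf cc a q k κ τ δ y0 y x' x0 e)
    hφu hux (B := a + q * k * E + κ * δ) (by positivity) (fun h => by
      rw [hgrad, hEdef]
      exact tf_semiconvex cc a k hq hκ.le hτ y0 y x' x0 e x2 h)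
  have hp := pucci_lower hL (2 * a + 2 * k * q * E + 2 * κ * δ) (4 * k ^ 2 * q * E)
    (κ * GG2 (⟪e, x2 - x0⟫ / τ)) (by positivity) (by positivity)
    (mul_nonneg hκ.le (GG2_nonneg _)) (x2 - x') e (hess (tf cc a q k κ τ δ y0 y x' x0 e) x2)
    (fun i j => by rw [hEdef]; exact hess_tf cc a q k κ δ hτ y0 y x' x0 e x2 i j)
  rw [hgrad] at htest
  have hnorm := norm_tg_le ha.le hq hk hκ.le hτ.le hδ.le y0 y x' x0 e x2 he
  rw [← hEdef] at hnorm
  have hval : tf cc a q k κ τ δ y0 y x' x0 e x2 ≤ c + q * E + 4 * κ * τ ^ 2 := by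
    have h1 := GG_le_four hs
    have h2 : κ * τ ^ 2 * GG (⟪e, x2 - x0⟫ / τ) ≤ κ * τ ^ 2 * 4 :=
      mul_le_mul_of_nonneg_left h1 (by positivity)
    have h3 : 0 ≤ κ * δ * ‖x2 - x0‖ ^ 2 := by positivity
    have h4 : 0 ≤ a / 2 * ‖x2 - y0‖ ^ 2 := by positivity
    have h5 : 0 ≤ a / 2 * ‖x2 - y‖ ^ 2 := by positivity
    unfold tf
    rw [← hEdef]
    linarith
  generalize tf cc a q k κ τ δ y0 y x' x0 e = φ at *
  have hG2 := GG2_ge hs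
  have g1 : κ * (1 / 624) * lam ≤ κ * GG2 (⟪e, x2 - x0⟫ / τ) * (lam * ‖e‖ ^ 2) := by
    rw [he, one_pow, mul_one]
    exact mul_le_mul_of_nonneg_right (mul_le_mul_of_nonneg_left hG2 hκ.le) hlam.le
  have g2 : (a + q * k * E + κ * δ + φ x2) * IK K
      ≤ (a + q * k * E + κ * δ + (c + q * E + 4 * κ * τ ^ 2)) * IK K :=
    mul_le_mul_of_nonneg_right (by linarith) hI
  have g3 : C0 * r * ‖tg a q k κ τ δ y0 y x' x0 e x2‖ ≤
      C0 * (a * ‖x2 - y0‖ + a * ‖x2 - y‖ + 2 * k * q * E * ‖x2 - x'‖ + 3 * κ * τ) := by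
    have h1 : C0 * r ≤ C0 := by nlinarith
    refine mul_le_mul h1 (hnorm.trans ?_) (norm_nonneg _) hC0
    have : κ * (δ * ‖x2 - x0‖) ≤ κ * τ := mul_le_mul_of_nonneg_left hx2n hκ.le
    linarith
  linarith

set_option maxHeartbeats 1000000 in
lemma pair_ineq {lam Lam C0 r : ℝ} {K f u : Ed d → ℝ} {O : Set (Ed d)} (hlam : 0 < lam)
    (hL : lam ≤ Lam) (hC0 : 0 ≤ C0)
    (hK : KernCond K) (hr : 0 < r) (hr1 : r ≤ 1) (hu : LowerSemicontinuous u)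
    (hu0 : ∀ x, 0 ≤ u x) (hub : IsBddFun u)
    (hsup : SupersolExtremal lam Lam C0 r K f O u)
    {a q k δ τ : ℝ} (ha : 0 < a) (hq : 0 ≤ q) (hk : 0 ≤ k) (hδ : 0 < δ) (hδ1 : δ ≤ 1) (hτ : 0 < τ)
    {y0 x' y yb x0 xb : Ed d} (hc0 : ∀ z, ob u a q k y0 x' y x0 ≤ ob u a q k y0 x' y z)
    (hcb : ∀ z, ob u a q k y0 x' yb xb ≤ ob u a q k y0 x' yb z)
    (hne : y ≠ yb) (hxx : ‖xb - x0‖ ≤ τ) (hO : closedBall x0 (τ / δ) ⊆ O) :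
    ∃ x2 ∈ closedBall x0 (τ / δ), ∃ κ E : ℝ, κ * τ = a * ‖yb - y‖ ∧ 0 < κ ∧
      E = Real.exp (-(k * ‖x2 - x'‖ ^ 2)) ∧
      f x2 ≤ (2 * a + 2 * k * q * E + 2 * κ * δ) * (d * Lam)
        - 4 * k ^ 2 * q * E * (lam * ‖x2 - x'‖ ^ 2) - κ * lam / 624
        + (a + q * k * E + κ * δ + (ob u a q k y0 x' y x0 + q * E + 4 * κ * τ ^ 2)) * IK K
        + C0 * (a * ‖x2 - y0‖ + a * ‖x2 - y‖ + 2 * k * q * E * ‖x2 - x'‖ + 3 * κ * τ) := by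
  have hI := IK_nonneg hK
  have hn : 0 < ‖yb - y‖ := norm_pos_iff.2 (sub_ne_zero.2 hne.symm)
  obtain ⟨κ, hκdef⟩ : ∃ κ, κ = a * ‖yb - y‖ / τ := ⟨_, rfl⟩
  have hκτ : κ * τ = a * ‖yb - y‖ := by rw [hκdef]; field_simp
  have hκ : 0 < κ := by rw [hκdef]; positivity
  obtain ⟨e, hedef⟩ : ∃ e, e = ‖yb - y‖⁻¹ • (yb - y) := ⟨_, rfl⟩
  have he : ‖e‖ = 1 := by
    rw [hedef, norm_smul, norm_inv, norm_norm, inv_mul_cancel₀ hn.ne']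
  have hye : yb - y = ‖yb - y‖ • e := by
    rw [hedef, smul_smul, mul_inv_cancel₀ hn.ne', one_smul]
  obtain ⟨c, hc⟩ : ∃ c, c = ob u a q k y0 x' y x0 := ⟨_, rfl⟩
  rw [← hc] at hc0 ⊢
  -- lower bound for the objective function
  have hlow : ∀ z, κ * τ ^ 2 * max (⟪e, z - x0⟫ / τ - 1) 0 ≤ ob u a q k y0 x' y z - c := by
    intro z
    rw [mul_max_of_nonneg _ _ (by positivity)]
    refine max_le ?_ (by simpa using hc0 z)
    have h1 := hcb z
    have h2 := hc0 xb
    have hexp : ∀ w : Ed d, ‖w - y‖ ^ 2 - ‖w - yb‖ ^ 2 = 2 * ⟪w, yb - y⟫ + ‖y‖ ^ 2 - ‖yb‖ ^ 2 := by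
      intro w
      rw [norm_sub_sq_real, norm_sub_sq_real, inner_sub_right]
      ring
    have h3 : ob u a q k y0 x' y z = ob u a q k y0 x' yb z
        + a / 2 * (‖z - y‖ ^ 2 - ‖z - yb‖ ^ 2) := by unfold ob; ring
    have h4 : ob u a q k y0 x' y xb = ob u a q k y0 x' yb xb
        + a / 2 * (‖xb - y‖ ^ 2 - ‖xb - yb‖ ^ 2) := by unfold ob; ring
    rw [hexp] at h3 h4
    have h5 : ⟪z, yb - y⟫ - ⟪xb, yb - y⟫ = ‖yb - y‖ * (⟪e, z - x0⟫ - ⟪e, xb - x0⟫) := by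
      rw [← inner_sub_left, ← inner_sub_right]
      conv_lhs => rw [hye]
      rw [inner_smul_right, real_inner_comm]
      congr 2
      abel
    have h6 : ⟪e, xb - x0⟫ ≤ τ := by
      refine (real_inner_le_norm _ _).trans ?_
      rw [he, one_mul]; exact hxx
    have h7 : κ * τ ^ 2 * (⟪e, z - x0⟫ / τ - 1) = κ * τ * (⟪e, z - x0⟫ - τ) := by
      field_simp
    rw [h7, hκτ]
    have h8 : a * ‖yb - y‖ * (⟪e, z - x0⟫ - τ) ≤ a * (⟪z, yb - y⟫ - ⟪xb, yb - y⟫) := by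
      rw [h5, ← mul_assoc]
      exact mul_le_mul_of_nonneg_left (by linarith) (by positivity)
    linarith
  -- minimize
  obtain ⟨w, hw'⟩ : ∃ w : Ed d → ℝ, w = fun z => ob u a q k y0 x' y z
    + (κ * δ * ‖z - x0‖ ^ 2 - κ * τ ^ 2 * GG (⟪e, z - x0⟫ / τ) - c) := ⟨_, rfl⟩
  have hw : ∀ z, w z = ob u a q k y0 x' y z
    + (κ * δ * ‖z - x0‖ ^ 2 - κ * τ ^ 2 * GG (⟪e, z - x0⟫ / τ) - c) := fun z => by rw [hw']
  have hwlsc : LowerSemicontinuous w := by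
    rw [hw']
    refine (ob_lsc hu a q k y0 x' y).add (Continuous.lowerSemicontinuous ?_)
    have := contDiff_GG.continuous
    fun_prop
  have hwx0 : w x0 = -(κ * τ ^ 2 / 8) := by
    rw [hw, sub_self, norm_zero, inner_zero_right, zero_div, GG_zero, ← hc]; ring
  have hwlow : ∀ z, κ * τ ^ 2 * (max (⟪e, z - x0⟫ / τ - 1) 0 - GG (⟪e, z - x0⟫ / τ))
      + κ * δ * ‖z - x0‖ ^ 2 ≤ w z := by
    intro z
    have := hlow z
    rw [hw]
    linarith
  have hx0m : x0 ∈ closedBall x0 (τ / δ) := mem_closedBall_self (by positivity)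
  obtain ⟨x2, hx2, hmin⟩ := exists_global_min hwlsc hx0m (by
    intro z hz
    rw [hwx0]
    refine le_trans ?_ (hwlow z)
    have hz' : τ / δ < ‖z - x0‖ := by
      rw [mem_closedBall, dist_eq_norm] at hz; exact not_le.1 hz
    have h1 : τ ^ 2 ≤ δ * ‖z - x0‖ ^ 2 := by
      have h2 : (τ / δ) ^ 2 ≤ ‖z - x0‖ ^ 2 := by gcongr
      have h3 : δ * (τ / δ) ^ 2 = τ ^ 2 / δ := by field_simp
      have h4 : τ ^ 2 ≤ τ ^ 2 / δ := by
        rw [le_div_iff₀ hδ]; nlinarith [sq_nonneg τ]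
      nlinarith
    have h5 := GG_le_one (⟪e, z - x0⟫ / τ)
    have h6 : κ * τ ^ 2 * (GG (⟪e, z - x0⟫ / τ) - max (⟪e, z - x0⟫ / τ - 1) 0) ≤ κ * τ ^ 2 * 1 :=
      mul_le_mul_of_nonneg_left h5 (by positivity)
    have h7 : κ * τ ^ 2 ≤ κ * (δ * ‖z - x0‖ ^ 2) := mul_le_mul_of_nonneg_left h1 hκ.le
    have h8 : 0 ≤ κ * τ ^ 2 / 8 := by positivity
    linarith)
  have hwx2 : w x2 ≤ -(κ * τ ^ 2 / 8) := hwx0 ▸ hmin x0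
  have hwx2' : w x2 ≤ 0 := hwx2.trans (by simp; positivity)
  have hs : |⟪e, x2 - x0⟫ / τ| ≤ 5 := by
    apply GG_range
    have h1 := hwlow x2
    have h2 : 0 ≤ κ * δ * ‖x2 - x0‖ ^ 2 := by positivity
    have h3 : 0 < κ * τ ^ 2 := by positivity
    by_contra hcon
    rw [not_lt] at hcon
    have : 0 ≤ κ * τ ^ 2 * (max (⟪e, x2 - x0⟫ / τ - 1) 0 - GG (⟪e, x2 - x0⟫ / τ)) :=
      mul_nonneg h3.le (by linarith)
    linarith
  -- the test function
  have hφw : ∀ z, tf (c + w x2) a q k κ τ δ y0 y x' x0 e z = u z - w z + w x2 := by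
    intro z
    rw [hw z]
    unfold tf ob
    ring
  have hx2n : δ * ‖x2 - x0‖ ≤ τ := by
    rw [mem_closedBall, dist_eq_norm, le_div_iff₀ hδ] at hx2
    linarith
  exact ⟨x2, hx2, κ, _, hκτ, hκ, rfl, touch_ineq hlam hL hC0 hK hr hr1 hu0 hub hsup ha hq hk hδ hτ
    hκ he (fun z => by rw [hφw]; linarith [hmin z]) (by rw [hφw]; ring) (by linarith) (hO hx2)
    hx2n hs rfl⟩

end Pair

section Meas
variable {d : ℕ}

lemma volume_image_le_of_lipschitzOn {f : Ed d → Ed d} {s : Set (Ed d)} {L : ℝ} (hL : 0 ≤ L)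
    (h : ∀ x ∈ s, ∀ y ∈ s, dist (f x) (f y) ≤ L * dist x y) :
    volume (f '' s) ≤ ENNReal.ofReal L ^ d * volume s := by
  have hl : LipschitzOnWith (Real.toNNReal L) f s := by
    refine LipschitzOnWith.of_dist_le_mul fun x hx y hy => ?_
    rw [Real.coe_toNNReal _ hL]; exact h x hx y hy
  have h1 := hl.hausdorffMeasure_image_le (d := (d : ℝ)) (by positivity)
  rw [← EuclideanSpace.euclideanHausdorffMeasure_eq_volume d,
    Measure.euclideanHausdorffMeasure_def, Measure.smul_apply, Measure.smul_apply,
    ENNReal.smul_def, ENNReal.smul_def, smul_eq_mul, smul_eq_mul, mul_left_comm]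
  refine mul_le_mul_right (h1.trans (le_of_eq ?_)) _
  rw [ENNReal.rpow_natCast]
  rfl

lemma measure_lemma {S E Kc : Set (Ed d)} (hSm : IsCompact S) (hKc : IsCompact Kc) (hSK : S ⊆ Kc)
    {Rel : Ed d → Ed d → Prop} (hE : ∀ y ∈ E, ∃ x ∈ S, Rel x y) {F : Ed d → ℝ}
    (hF : ContinuousOn F Kc) (hF0 : ∀ x, 0 ≤ F x) {L H τ1 : ℝ} (hL : 0 ≤ L) (hH : 0 ≤ H)
    (hτ1 : 0 < τ1)
    (hp : ∀ x0 ∈ S, ∀ xb ∈ S, ∀ y yb, Rel x0 y → Rel xb yb → ∀ τ, 0 < τ → τ ≤ τ1 →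
      dist x0 xb ≤ τ → ∃ x2 ∈ Kc, dist x2 x0 ≤ H * τ ∧ dist y yb ≤ L * F x2 * τ)
    {ε : ℝ} (hε : 0 < ε) :
    volume E ≤ ∫⁻ x in S, ENNReal.ofReal (L * (F x + ε)) ^ d := by
  obtain ⟨T, hT⟩ : ∃ T : Ed d → Ed d, ∀ x, (∃ y, Rel x y) → Rel x (T x) := by
    classical
    refine ⟨fun x => if h : ∃ y, Rel x y then h.choose else 0, fun x h => ?_⟩
    simp only [dif_pos h]
    exact h.choose_spec
  obtain ⟨B, hB⟩ : ∃ B, ∀ x ∈ Kc, F x ≤ B := by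
    obtain ⟨B, hB⟩ := hKc.bddAbove_image hF
    exact ⟨B, fun x hx => hB (mem_image_of_mem _ hx)⟩
  obtain ⟨D, hD⟩ : ∃ D : Set (Ed d), D = {x | x ∈ S ∧ ∃ y, Rel x y} := ⟨_, rfl⟩
  have hsingle : ∀ x ∈ S, ∀ y, Rel x y → T x = y := by
    intro x hx y hy
    have hy' := hT x ⟨y, hy⟩
    by_contra hne
    have hpos : 0 < dist (T x) y := dist_pos.2 hne
    have hBB : 0 < |L * B| + 1 := by positivity
    obtain ⟨x2, hx2, -, h2⟩ := hp x hx x hx _ _ hy' hy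
      (min τ1 (dist (T x) y / (|L * B| + 1) / 2)) (by positivity) (min_le_left _ _)
      (by rw [dist_self]; positivity)
    have h3 : L * F x2 ≤ |L * B| :=
      (mul_le_mul_of_nonneg_left (hB x2 hx2) hL).trans (le_abs_self _)
    have h4 : L * F x2 * min τ1 (dist (T x) y / (|L * B| + 1) / 2)
        ≤ (|L * B| + 1) * (dist (T x) y / (|L * B| + 1) / 2) := by
      refine mul_le_mul (by linarith) (min_le_right _ _) (by positivity) hBB.le
    have h5 : (|L * B| + 1) * (dist (T x) y / (|L * B| + 1) / 2) = dist (T x) y / 2 := by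
      field_simp
    linarith
  have hET : E ⊆ T '' D := by
    intro y hy
    obtain ⟨x, hx, hr⟩ := hE y hy
    exact ⟨x, hD ▸ ⟨hx, y, hr⟩, hsingle x hx y hr⟩
  have huc := hKc.uniformContinuousOn_of_continuous hF
  rw [Metric.uniformContinuousOn_iff] at huc
  obtain ⟨η, hη, huc⟩ := huc (ε / 2) (by positivity)
  obtain ⟨ρ, hρdef⟩ : ∃ ρ, ρ = min τ1 (η / (H + 1) / 2) / 2 := ⟨_, rfl⟩
  have hρ : 0 < ρ := by rw [hρdef]; positivity
  have hρ1 : 2 * ρ ≤ τ1 := by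
    have := min_le_left τ1 (η / (H + 1) / 2)
    linarith
  have hρ2 : (H + 1) * (2 * ρ) < η := by
    have h1 := min_le_right τ1 (η / (H + 1) / 2)
    have h2 : (H + 1) * (2 * ρ) ≤ (H + 1) * (η / (H + 1) / 2) :=
      mul_le_mul_of_nonneg_left (by linarith) (by positivity)
    have h3 : (H + 1) * (η / (H + 1) / 2) = η / 2 := by field_simp
    linarith
  -- one piece
  have hpiece : ∀ P : Set (Ed d), MeasurableSet P → P ⊆ S → (∀ x ∈ P, ∀ x' ∈ P, dist x x' ≤ 2 * ρ) →
      volume (T '' (P ∩ D)) ≤ ∫⁻ x in P, ENNReal.ofReal (L * (F x + ε)) ^ d := by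
    intro P hPm hPS hPd
    rcases P.eq_empty_or_nonempty with rfl | ⟨p, hpP⟩
    · simp
    have hlip : ∀ x ∈ P ∩ D, ∀ x' ∈ P ∩ D,
        dist (T x) (T x') ≤ (L * (F p + ε / 2)) * dist x x' := by
      intro x hx x' hx'
      rcases eq_or_ne x x' with rfl | hne
      · simp
      rw [hD] at hx hx'
      have hd := hPd x hx.1 x' hx'.1
      obtain ⟨x2, hx2, h1, h2⟩ := hp x hx.2.1 x' hx'.2.1 _ _ (hT x hx.2.2) (hT x' hx'.2.2)
        (dist x x') (dist_pos.2 hne) (hd.trans hρ1) le_rfl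
      refine h2.trans (mul_le_mul_of_nonneg_right (mul_le_mul_of_nonneg_left ?_ hL) dist_nonneg)
      have h3 : dist x2 p < η := by
        have := hPd x hx.1 p hpP
        have h4 := dist_triangle x2 x p
        have h5 : H * dist x x' ≤ H * (2 * ρ) := mul_le_mul_of_nonneg_left hd hH
        linarith
      have h4 := huc x2 hx2 p (hSK (hPS hpP)) h3
      rw [Real.dist_eq] at h4
      have := abs_lt.1 h4
      linarith
    have hFp := hF0 p
    refine (volume_image_le_of_lipschitzOn (by positivity) hlip).trans ?_
    refine (mul_le_mul_right (measure_mono inter_subset_left) _).trans ?_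
    rw [← setLIntegral_const]
    refine setLIntegral_mono' hPm fun x hx => ?_
    refine pow_le_pow_left' (ENNReal.ofReal_le_ofReal (mul_le_mul_of_nonneg_left ?_ hL)) _
    have h3 : dist p x < η := by
      have := hPd p hpP x hx
      have : 0 ≤ H * (2 * ρ) := by positivity
      linarith
    have h4 := huc p (hSK (hPS hpP)) x (hSK (hPS hx)) h3
    rw [Real.dist_eq] at h4
    have := abs_lt.1 h4
    linarith
  -- finite induction
  have hind : ∀ t : Finset (Ed d), ∀ P : Set (Ed d), MeasurableSet P → P ⊆ S →
      P ⊆ ⋃ x ∈ t, ball x ρ →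
      volume (T '' (P ∩ D)) ≤ ∫⁻ x in P, ENNReal.ofReal (L * (F x + ε)) ^ d := by
    classical
    intro t
    induction t using Finset.induction_on with
    | empty =>
      intro P _ _ h
      have : P = ∅ := by simpa using h
      simp [this]
    | insert a t _ ih =>
      intro P hPm hPS hPt
      have h1 := hpiece (P ∩ ball a ρ) (hPm.inter measurableSet_ball) (inter_subset_left.trans hPS)
        (fun x hx x' hx' => by
          have e1 := mem_ball.1 hx.2
          have e2 := mem_ball'.1 hx'.2
          have := dist_triangle x a x'
          linarith)
      have h2 := ih (P \ ball a ρ) (hPm.diff measurableSet_ball) (sdiff_subset.trans hPS)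
        (fun x hx => by
          have := hPt hx.1
          simp only [Finset.mem_insert, iUnion_iUnion_eq_or_left, mem_union] at this
          exact this.resolve_left hx.2)
      rw [← lintegral_inter_add_sdiff _ P (measurableSet_ball (x := a) (ε := ρ))]
      refine le_trans ?_ (add_le_add h1 h2)
      refine (measure_mono ?_).trans (measure_union_le _ _)
      rw [← image_union]
      refine image_mono ?_
      rw [← union_inter_distrib_right, inter_union_sdiff]
  obtain ⟨t, -, htf, ht⟩ := hSm.finite_cover_balls hρ
  refine (measure_mono hET).trans ?_
  have hDS : D = S ∩ D := by rw [hD]; ext x; simp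
  rw [hDS]
  refine hind htf.toFinset S hSm.isClosed.measurableSet le_rfl ?_
  simpa using ht

end Meas

section Arith

/-- the continuous cutoff -/
def cutg (t : ℝ) : ℝ := max 0 (min 1 (2 - 2 * t))

lemma cutg_nonneg (t : ℝ) : 0 ≤ cutg t := le_max_left _ _
lemma cutg_le_one (t : ℝ) : cutg t ≤ 1 := max_le zero_le_one (min_le_left _ _)
lemma cutg_eq_one {t : ℝ} (h : t ≤ 1 / 2) : cutg t = 1 := by
  unfold cutg
  rw [min_eq_left (by linarith), max_eq_right zero_le_one]
lemma cutg_eq_zero {t : ℝ} (h : 1 ≤ t) : cutg t = 0 := by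
  unfold cutg
  exact max_eq_left ((min_le_right _ _).trans (by linarith))
lemma continuous_cutg : Continuous cutg := by unfold cutg; fun_prop

set_option maxHeartbeats 1000000 in
lemma arith_consts {D lam Lam C0 I n : ℝ} (hD : 0 ≤ D) (hlam : 0 < lam) (hL : 0 ≤ Lam)
    (hC0 : 0 ≤ C0) (hI : 0 ≤ I) (hn : 1 ≤ n) :
    ∃ p M0 C3 δ τ1 : ℝ, 1 ≤ p ∧ 0 ≤ M0 ∧ 0 ≤ C3 ∧ 0 < δ ∧ δ ≤ 1 ∧ 0 < τ1 ∧
      ∀ a s κ τ t E f2 c e0 e1 : ℝ, 0 < a → 0 < s → s ≤ n → 0 < κ → 0 < τ → τ ≤ τ1 → 0 ≤ t → t ≤ 11 →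
        E = Real.exp (-(p * t ^ 2)) → c ≤ 91 * n ^ 2 * a → e0 ≤ 18 * n → e1 ≤ 18 * n →
        f2 ≤ (2 * a + 2 * (a * p * M0) * E + 2 * κ * δ) * (D * Lam)
          - 4 * (a * p ^ 2 * M0) * E * (lam * t ^ 2) - κ * lam / 624
          + (a + a * p * M0 * E + κ * δ + (c + a * s ^ 2 * M0 * E + 4 * κ * τ ^ 2)) * I
          + C0 * (a * e0 + a * e1 + 2 * (a * p * M0) * E * (s * t) + 3 * κ * τ) →
        κ * (lam / 1248) ≤ |f2| + C3 * a * cutg t := by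
  obtain ⟨c6, hc6⟩ : ∃ c6, c6 = 2 * D * Lam + I + n ^ 2 * I := ⟨_, rfl⟩
  have hc60 : 0 ≤ c6 := by rw [hc6]; positivity
  obtain ⟨C2, hC2⟩ : ∃ C2, C2 = 2 * D * Lam + I + 91 * n ^ 2 * I + 36 * n * C0 := ⟨_, rfl⟩
  have hC20 : 0 ≤ C2 := by rw [hC2]; positivity
  obtain ⟨p, hp⟩ : ∃ p, p = 1 + 2 * (c6 + C0 * n) / lam := ⟨_, rfl⟩
  have hp1 : 1 ≤ p := by
    rw [hp]
    have : 0 ≤ 2 * (c6 + C0 * n) / lam := by positivity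
    linarith
  have hp2 : 2 * (c6 + C0 * n) ≤ p * lam := by
    have : 2 * (c6 + C0 * n) / lam * lam = 2 * (c6 + C0 * n) := by field_simp
    rw [hp, add_mul, this]; linarith
  have hp0 : 0 < p := by linarith
  obtain ⟨M0, hM0⟩ : ∃ M0, M0 = 2 * C2 * Real.exp (121 * p) / (p ^ 2 * lam) := ⟨_, rfl⟩
  have hM00 : 0 ≤ M0 := by rw [hM0]; positivity
  have hM0e : M0 * Real.exp (-(121 * p)) * (p ^ 2 * lam / 2) = C2 := by
    rw [hM0, Real.exp_neg]; field_simp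
  obtain ⟨δ, hδ⟩ : ∃ δ, δ = min 1 (lam / 2496 / (2 * (D * Lam) + I + 1)) := ⟨_, rfl⟩
  have hδ0 : 0 < δ := by rw [hδ]; positivity
  have hδ1 : δ ≤ 1 := hδ ▸ min_le_left _ _
  have hδ2 : δ * (2 * (D * Lam) + I) ≤ lam / 2496 := by
    have h1 : δ ≤ lam / 2496 / (2 * (D * Lam) + I + 1) := hδ ▸ min_le_right _ _
    rw [le_div_iff₀ (by positivity)] at h1
    nlinarith
  obtain ⟨τ1, hτ1⟩ : ∃ τ1, τ1 = min 1 (lam / 2496 / (4 * I + 3 * C0 + 1)) := ⟨_, rfl⟩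
  have hτ10 : 0 < τ1 := by rw [hτ1]; positivity
  refine ⟨p, M0, C2 + M0 * (p * (c6 + C0 * n)), δ, τ1, hp1, hM00, by positivity, hδ0, hδ1, hτ10, ?_⟩
  intro a s κ τ t E f2 c e0 e1 ha hs hsn hκ hτ hττ ht ht11 hE hc he0 he1 hf
  have hE0 : 0 < E := by rw [hE]; exact Real.exp_pos _
  have hE1 : E ≤ 1 := by
    rw [hE]; apply Real.exp_le_one_iff.2
    have : 0 ≤ p * t ^ 2 := by positivity
    linarith
  have hE2 : Real.exp (-(121 * p)) ≤ E := by
    rw [hE]; apply Real.exp_le_exp.2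
    have h1 : t ^ 2 ≤ 11 ^ 2 := pow_le_pow_left₀ ht ht11 2
    have h2 : p * t ^ 2 ≤ p * 11 ^ 2 := mul_le_mul_of_nonneg_left h1 hp0.le
    linarith
  have hτ2 : 4 * τ ^ 2 * I + 3 * C0 * τ ≤ lam / 2496 := by
    have h1 : τ ≤ lam / 2496 / (4 * I + 3 * C0 + 1) := hττ.trans (hτ1 ▸ min_le_right _ _)
    rw [le_div_iff₀ (by positivity)] at h1
    have h2 : τ ≤ 1 := hττ.trans (hτ1 ▸ min_le_left _ _)
    have h3 : τ ^ 2 ≤ τ := by nlinarith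
    have h4 : τ ^ 2 * I ≤ τ * I := mul_le_mul_of_nonneg_right h3 hI
    linarith
  -- collect
  obtain ⟨Br, hBr⟩ : ∃ Br, Br = 2 * p * D * Lam - 4 * p ^ 2 * lam * t ^ 2 + p * I + s ^ 2 * I
    + 2 * C0 * p * s * t := ⟨_, rfl⟩
  have hmain : κ * (lam / 1248) ≤ |f2| + a * C2 + a * (M0 * E) * Br := by
    have k1 : κ * (δ * (2 * (D * Lam) + I)) ≤ κ * (lam / 2496) :=
      mul_le_mul_of_nonneg_left hδ2 hκ.le
    have k2 : κ * (4 * τ ^ 2 * I + 3 * C0 * τ) ≤ κ * (lam / 2496) :=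
      mul_le_mul_of_nonneg_left hτ2 hκ.le
    have k3 : c * I ≤ 91 * n ^ 2 * a * I := mul_le_mul_of_nonneg_right hc hI
    have k4 : C0 * a * e0 ≤ C0 * a * (18 * n) := mul_le_mul_of_nonneg_left he0 (by positivity)
    have k5 : C0 * a * e1 ≤ C0 * a * (18 * n) := mul_le_mul_of_nonneg_left he1 (by positivity)
    have k6 := neg_abs_le f2
    rw [hC2, hBr]
    linarith
  have hs2 : s ^ 2 ≤ n ^ 2 := by gcongr
  have hBr1 : Br ≤ p * (c6 + 2 * C0 * n * t) - 4 * p ^ 2 * lam * t ^ 2 := by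
    have k1 : s ^ 2 * I ≤ n ^ 2 * I := mul_le_mul_of_nonneg_right hs2 hI
    have k2 : 1 * (n ^ 2 * I) ≤ p * (n ^ 2 * I) := mul_le_mul_of_nonneg_right hp1 (by positivity)
    have k3 : 2 * C0 * p * t * s ≤ 2 * C0 * p * t * n := mul_le_mul_of_nonneg_left hsn (by positivity)
    rw [hBr, hc6]
    linarith
  rcases le_total t (1 / 2) with h | h
  · rw [cutg_eq_one h]
    have k0 : 2 * C0 * n * t ≤ C0 * n := by
      have : C0 * n * (2 * t) ≤ C0 * n * 1 := mul_le_mul_of_nonneg_left (by linarith) (by positivity)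
      linarith
    have k1 : Br ≤ p * (c6 + C0 * n) := by
      have : p * (c6 + 2 * C0 * n * t) ≤ p * (c6 + C0 * n) :=
        mul_le_mul_of_nonneg_left (by linarith) hp0.le
      have : 0 ≤ 4 * p ^ 2 * lam * t ^ 2 := by positivity
      linarith
    have k2 : a * (M0 * E) * Br ≤ a * (M0 * E) * (p * (c6 + C0 * n)) :=
      mul_le_mul_of_nonneg_left k1 (by positivity)
    have k3 : a * (M0 * E) * (p * (c6 + C0 * n)) ≤ a * (M0 * 1) * (p * (c6 + C0 * n)) := by
      refine mul_le_mul_of_nonneg_right ?_ (by positivity)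
      refine mul_le_mul_of_nonneg_left ?_ ha.le
      exact mul_le_mul_of_nonneg_left hE1 hM00
    linarith
  · have k1 : Br ≤ -(p ^ 2 * lam / 2) := by
      have ht2 : 1 / 4 ≤ t ^ 2 := by nlinarith
      have q1 : c6 ≤ 4 * c6 * t ^ 2 := by nlinarith
      have q2 : 2 * C0 * n * t ≤ 4 * (C0 * n) * t ^ 2 := by
        have : t ≤ 2 * t ^ 2 := by nlinarith
        have := mul_le_mul_of_nonneg_left this (by positivity : 0 ≤ 2 * (C0 * n))
        linarith
      have q3 : p * (c6 + 2 * C0 * n * t) ≤ p * (4 * (c6 + C0 * n) * t ^ 2) :=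
        mul_le_mul_of_nonneg_left (by linarith) hp0.le
      have q4 : p * t ^ 2 * (2 * (c6 + C0 * n)) ≤ p * t ^ 2 * (p * lam) :=
        mul_le_mul_of_nonneg_left hp2 (by positivity)
      have q5 : p ^ 2 * lam * (1 / 4) ≤ p ^ 2 * lam * t ^ 2 :=
        mul_le_mul_of_nonneg_left ht2 (by positivity)
      linarith
    have k2 : a * (M0 * E) * Br ≤ a * (M0 * E) * (-(p ^ 2 * lam / 2)) :=
      mul_le_mul_of_nonneg_left k1 (by positivity)
    have k3 : M0 * Real.exp (-(121 * p)) * (p ^ 2 * lam / 2) ≤ M0 * E * (p ^ 2 * lam / 2) :=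
      mul_le_mul_of_nonneg_right (mul_le_mul_of_nonneg_left hE2 hM00) (by positivity)
    rw [hM0e] at k3
    have k4 : a * C2 ≤ a * (M0 * E * (p ^ 2 * lam / 2)) := mul_le_mul_of_nonneg_left k3 ha.le
    have k5 : 0 ≤ (C2 + M0 * (p * (c6 + C0 * n))) * a * cutg t :=
      mul_nonneg (by positivity) (cutg_nonneg t)
    linarith

end Arith

section Growth
variable {d : ℕ}

/-- Contact set of concave paraboloids of opening `a` with vertices in the ball of radius `R`. -/
def Aset (u : Ed d → ℝ) (R a : ℝ) : Set (Ed d) :=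
  {x | ‖x‖ ≤ R ∧ ∃ y : Ed d, ‖y‖ ≤ R ∧ ∀ z, u x + a / 2 * ‖x - y‖ ^ 2 ≤ u z + a / 2 * ‖z - y‖ ^ 2}

lemma isCompact_contact {u : Ed d → ℝ} (hu : LowerSemicontinuous u) {g : Ed d → Ed d → ℝ}
    (hg : Continuous (Function.uncurry g)) {A B : Set (Ed d)} (hA : IsCompact A) (hB : IsCompact B) :
    IsCompact {x | x ∈ A ∧ ∃ y ∈ B, ∀ z, u x + g x y ≤ u z + g z y} := by
  have h : {x | x ∈ A ∧ ∃ y ∈ B, ∀ z, u x + g x y ≤ u z + g z y}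
      = Prod.fst '' ((A ×ˢ B) ∩ ⋂ z, {p : Ed d × Ed d | u p.1 + (g p.1 p.2 - g z p.2) ≤ u z}) := by
    ext x
    constructor
    · rintro ⟨hx, y, hy, h⟩
      refine ⟨(x, y), ⟨⟨hx, hy⟩, ?_⟩, rfl⟩
      rw [mem_iInter]; intro z
      have := h z
      simp only [mem_setOf_eq]; linarith
    · rintro ⟨⟨x', y⟩, ⟨⟨hx, hy⟩, h⟩, rfl⟩
      refine ⟨hx, y, hy, fun z => ?_⟩
      rw [mem_iInter] at h
      have := h z
      simp only [mem_setOf_eq] at this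
      simp only
      linarith
  rw [h]
  refine ((hA.prod hB).inter_right (isClosed_iInter fun z => ?_)).image continuous_fst
  have h1 : LowerSemicontinuous (fun p : Ed d × Ed d => u p.1 + (g p.1 p.2 - g z p.2)) := by
    refine (hu.comp continuous_fst).add (Continuous.lowerSemicontinuous ?_)
    have h2 : Continuous (fun p : Ed d × Ed d => g p.1 p.2) := hg
    have h3 : Continuous (fun p : Ed d × Ed d => g z p.2) :=
      hg.comp (continuous_const.prodMk continuous_snd)
    exact h2.sub h3
  exact h1.isClosed_preimage (u z)

lemma isCompact_Aset {u : Ed d → ℝ} (hu : LowerSemicontinuous u) (R a : ℝ) :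
    IsCompact (Aset u R a) := by
  have := isCompact_contact hu (g := fun x y => a / 2 * ‖x - y‖ ^ 2)
    (by simp only [Function.uncurry_def]; fun_prop)
    (isCompact_closedBall (0 : Ed d) R) (isCompact_closedBall (0 : Ed d) R)
  simpa only [Aset, mem_closedBall_zero_iff] using this

/-- vertex reconstruction -/
lemma mem_Aset_of_grad {u : Ed d → ℝ} {R N : ℝ} (hN : 0 < N) {x g : Ed d} (hx : ‖x‖ ≤ R)
    (hv : ‖x + N⁻¹ • g‖ ≤ R) (h : ∀ z, u x + ⟪g, z - x⟫ - N / 2 * ‖z - x‖ ^ 2 ≤ u z) :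
    x ∈ Aset u R N := by
  refine ⟨hx, _, hv, fun z => ?_⟩
  have h1 := h z
  have e1 : x - (x + N⁻¹ • g) = -(N⁻¹ • g) := by abel
  have e2 : z - (x + N⁻¹ • g) = (z - x) - N⁻¹ • g := by abel
  rw [e1, e2, norm_neg, norm_sub_sq_real, inner_smul_right, real_inner_comm]
  have e3 : N / 2 * (‖z - x‖ ^ 2 - 2 * (N⁻¹ * ⟪g, z - x⟫) + ‖N⁻¹ • g‖ ^ 2)
      = N / 2 * ‖z - x‖ ^ 2 - ⟪g, z - x⟫ + N / 2 * ‖N⁻¹ • g‖ ^ 2 := by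
    field_simp
  rw [e3]
  linarith

lemma Aset_mono {u : Ed d → ℝ} {R a M : ℝ} (ha : 0 < a) (hM : 1 ≤ M) :
    Aset u R a ⊆ Aset u R (M * a) := by
  rintro x ⟨hx, y, hy, h⟩
  have hM0 : 0 < M := by linarith
  refine mem_Aset_of_grad (g := a • (y - x)) (by positivity) hx ?_ ?_
  · have e : x + (M * a)⁻¹ • a • (y - x) = (1 - M⁻¹) • x + M⁻¹ • y := by
      rw [smul_smul]
      have : (M * a)⁻¹ * a = M⁻¹ := by field_simp
      rw [this]; module
    have hMi : M⁻¹ ≤ 1 := inv_le_one_of_one_le₀ hM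
    have hMi0 : 0 < M⁻¹ := by positivity
    rw [e]
    refine (norm_add_le _ _).trans ?_
    rw [norm_smul, norm_smul, Real.norm_of_nonneg (by linarith), Real.norm_of_nonneg hMi0.le]
    nlinarith
  · intro z
    have h1 := h z
    have e2 : z - y = (z - x) + (x - y) := by abel
    rw [e2, norm_add_sq_real] at h1
    have e3 : ⟪a • (y - x), z - x⟫ = -(a * ⟪z - x, x - y⟫) := by
      rw [inner_smul_left, real_inner_comm, ← neg_sub x y, inner_neg_right]; simp
    rw [e3]
    have : 0 ≤ (M - 1) * a * ‖z - x‖ ^ 2 :=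
      mul_nonneg (mul_nonneg (by linarith) ha.le) (by positivity)
    linarith

/-- contact with the bumped function gives contact with a paraboloid -/
lemma contact_mem_Aset {u : Ed d → ℝ} {a q k R M c1 : ℝ} (ha : 0 < a) (hq : 0 ≤ q) (hk : 0 ≤ k)
    (hkq : q * k = a * c1) (hM : M = 2 + 2 * c1)
    {y0 x' y x : Ed d} (hc : ∀ z, ob u a q k y0 x' y x ≤ ob u a q k y0 x' y z)
    (hx : ‖x‖ ≤ R) (hy0 : ‖y0‖ ≤ R) (hy : ‖y‖ ≤ R) (hx' : ‖x'‖ ≤ R) :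
    x ∈ Aset u R (M * a) := by
  have hc1 : 0 ≤ c1 := by
    have : 0 ≤ a * c1 := hkq ▸ mul_nonneg hq hk
    exact nonneg_of_mul_nonneg_right this ha
  have hM0 : 0 < M := by rw [hM]; positivity
  obtain ⟨E, hE⟩ : ∃ E, E = Real.exp (-(k * ‖x - x'‖ ^ 2)) := ⟨_, rfl⟩
  have hE0 : 0 < E := by rw [hE]; exact Real.exp_pos _
  have hE1 : E ≤ 1 := by
    rw [hE]; apply Real.exp_le_one_iff.2
    have : 0 ≤ k * ‖x - x'‖ ^ 2 := by positivity
    linarith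
  have htf : ∀ z, tf (ob u a q k y0 x' y x) a q k 0 1 0 y0 y x' x 0 z
      = ob u a q k y0 x' y x - ob u a q k y0 x' y z + u z := by
    intro z; unfold tf ob; ring
  refine mem_Aset_of_grad (g := tg a q k 0 1 0 y0 y x' x 0 x) (by positivity) hx ?_ ?_
  · have e : x + (M * a)⁻¹ • tg a q k 0 1 0 y0 y x' x 0 x
        = (1 - 2 * M⁻¹ - 2 * c1 * E * M⁻¹) • x + M⁻¹ • y0 + M⁻¹ • y + (2 * c1 * E * M⁻¹) • x' := by
      have e1 : (M * a)⁻¹ * a = M⁻¹ := by field_simp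
      have e2 : (M * a)⁻¹ * (2 * k * q * E) = 2 * c1 * E * M⁻¹ := by
        have : 2 * k * q * E = a * (2 * c1 * E) := by linear_combination 2 * E * hkq
        rw [this]; field_simp
      have e3 : tg a q k 0 1 0 y0 y x' x 0 x
          = -(a • (x - y0)) - a • (x - y) - (2 * k * q * E) • (x - x') := by
        unfold tg
        rw [← hE]
        simp [smul_smul]
      rw [e3, smul_sub, smul_sub, smul_neg, smul_smul, smul_smul, smul_smul, e1, e2]
      module
    have hMi0 : 0 < M⁻¹ := by positivity
    have hMM : M * M⁻¹ = 1 := mul_inv_cancel₀ hM0.ne'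
    have hb : 0 ≤ 2 * c1 * E * M⁻¹ := by positivity
    have hco : 0 ≤ 1 - 2 * M⁻¹ - 2 * c1 * E * M⁻¹ := by
      have : c1 * M⁻¹ * E ≤ c1 * M⁻¹ * 1 := mul_le_mul_of_nonneg_left hE1 (by positivity)
      nlinarith
    rw [e]
    refine (norm_add_le _ _).trans ((add_le_add_left (norm_add_le _ _) _).trans
      ((add_le_add_left (add_le_add_left (norm_add_le _ _) _) _).trans ?_))
    rw [norm_smul, norm_smul, norm_smul, norm_smul, Real.norm_of_nonneg hco,
      Real.norm_of_nonneg hMi0.le, Real.norm_of_nonneg hb]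
    have k1 := mul_le_mul_of_nonneg_left hx hco
    have k2 := mul_le_mul_of_nonneg_left hy0 hMi0.le
    have k3 := mul_le_mul_of_nonneg_left hy hMi0.le
    have k4 := mul_le_mul_of_nonneg_left hx' hb
    linarith
  · intro z
    have h1 := tf_semiconvex (ob u a q k y0 x' y x) a k hq le_rfl one_pos y0 y x' x 0 x (z - x)
      (δ := 0)
    rw [add_sub_cancel, htf, htf, ← hE] at h1
    have h2 := hc z
    have h3 : (a + q * k * E + 0 * 0) * ‖z - x‖ ^ 2 ≤ M * a / 2 * ‖z - x‖ ^ 2 := by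
      refine mul_le_mul_of_nonneg_right ?_ (by positivity)
      rw [hkq, hM]
      have : a * c1 * E ≤ a * c1 * 1 := mul_le_mul_of_nonneg_left hE1 (by positivity)
      linarith
    linarith

end Growth

section GrowthPair
variable {d : ℕ}

/-- The arithmetic property of the constants. -/
def ArithP (D lam Lam C0 I n p M0 C3 δ τ1 : ℝ) : Prop :=
      ∀ a s κ τ t E f2 c e0 e1 : ℝ, 0 < a → 0 < s → s ≤ n → 0 < κ → 0 < τ → τ ≤ τ1 → 0 ≤ t → t ≤ 11 →
        E = Real.exp (-(p * t ^ 2)) → c ≤ 91 * n ^ 2 * a → e0 ≤ 18 * n → e1 ≤ 18 * n →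
        f2 ≤ (2 * a + 2 * (a * p * M0) * E + 2 * κ * δ) * (D * Lam)
          - 4 * (a * p ^ 2 * M0) * E * (lam * t ^ 2) - κ * lam / 624
          + (a + a * p * M0 * E + κ * δ + (c + a * s ^ 2 * M0 * E + 4 * κ * τ ^ 2)) * I
          + C0 * (a * e0 + a * e1 + 2 * (a * p * M0) * E * (s * t) + 3 * κ * τ) →
        κ * (lam / 1248) ≤ |f2| + C3 * a * cutg t

lemma growth_pair {lam Lam C0 r n p M0 C3 δ τ1 : ℝ} {K f u : Ed d → ℝ} (hlam : 0 < lam)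
    (hL : lam ≤ Lam) (hC0 : 0 ≤ C0) (hK : KernCond K) (hr : 0 < r) (hr1 : r ≤ 1)
    (hu : LowerSemicontinuous u) (hu0 : ∀ x, 0 ≤ u x) (hub : IsBddFun u)
    (hsup : SupersolExtremal lam Lam C0 r K f (ball 0 (9 * n)) u)
    (hp : 1 ≤ p) (hM0 : 0 ≤ M0) (hC3 : 0 ≤ C3) (hδ : 0 < δ) (hδ1 : δ ≤ 1)
    (hA : ArithP d lam Lam C0 (IK K) n p M0 C3 δ τ1)
    {a s : ℝ} (ha : 0 < a) (hs : 0 < s) (hsn : s ≤ n) {x' y0 : Ed d} (hx' : ‖x'‖ + 11 * s < 9 * n)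
    (hy0 : ‖y0‖ ≤ 9 * n) {y yb x0 xb : Ed d} (hy : ‖y‖ ≤ 9 * n)
    (hc0 : ∀ z, ob u a (a * s ^ 2 * M0) (p / s ^ 2) y0 x' y x0
      ≤ ob u a (a * s ^ 2 * M0) (p / s ^ 2) y0 x' y z)
    (hcb : ∀ z, ob u a (a * s ^ 2 * M0) (p / s ^ 2) y0 x' yb xb
      ≤ ob u a (a * s ^ 2 * M0) (p / s ^ 2) y0 x' yb z)
    (hc : ob u a (a * s ^ 2 * M0) (p / s ^ 2) y0 x' y x0 ≤ 91 * n ^ 2 * a)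
    (hx0 : x0 ∈ closedBall x' (10 * s)) {τ : ℝ} (hτ : 0 < τ) (hτ1 : τ ≤ τ1) (hτδ : τ ≤ δ * s)
    (hxx : dist x0 xb ≤ τ) :
    ∃ x2 ∈ closedBall x' (11 * s), dist x2 x0 ≤ δ⁻¹ * τ ∧
      dist y yb ≤ 1248 / (lam * a) * (|f x2| + C3 * a * cutg (‖x2 - x'‖ / s)) * τ := by
  rw [mem_closedBall] at hx0
  rcases eq_or_ne y yb with rfl | hne
  · refine ⟨x0, ?_, ?_, ?_⟩
    · rw [mem_closedBall]; linarith
    · rw [dist_self]; positivity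
    · rw [dist_self]
      have := cutg_nonneg (‖x0 - x'‖ / s)
      positivity
  have hsub : closedBall x0 (τ / δ) ⊆ closedBall x' (11 * s) := by
    refine closedBall_subset_closedBall' ?_
    have : τ / δ ≤ s := by rw [div_le_iff₀ hδ]; linarith
    linarith
  have hsub2 : closedBall x' (11 * s) ⊆ ball (0 : Ed d) (9 * n) := by
    intro z hz
    rw [mem_closedBall, dist_eq_norm] at hz
    rw [mem_ball_zero_iff]
    have : ‖z‖ ≤ ‖z - x'‖ + ‖x'‖ := by
      simpa using norm_add_le (z - x') x'
    linarith
  have hp0 : 0 < p := by linarith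
  obtain ⟨x2, hx2, κ, E, hκτ, hκ, hE, hf⟩ := pair_ineq hlam hL hC0 hK hr hr1 hu hu0 hub hsup ha
    (by positivity : 0 ≤ a * s ^ 2 * M0) (by positivity : 0 ≤ p / s ^ 2) hδ hδ1 hτ hc0 hcb hne
    (by rwa [dist_comm, dist_eq_norm] at hxx) (hsub.trans hsub2)
  refine ⟨x2, hsub hx2, ?_, ?_⟩
  · rw [mem_closedBall] at hx2
    rwa [div_eq_inv_mul] at hx2
  have hx2' := hsub hx2
  have hx2n := hsub2 hx2'
  rw [mem_closedBall, dist_eq_norm] at hx2'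
  rw [mem_ball_zero_iff] at hx2n
  obtain ⟨t, ht⟩ : ∃ t, t = ‖x2 - x'‖ / s := ⟨_, rfl⟩
  have hts : ‖x2 - x'‖ = s * t := by rw [ht]; field_simp
  have ht0 : 0 ≤ t := by rw [ht]; positivity
  have ht11 : t ≤ 11 := by rw [ht, div_le_iff₀ hs]; exact hx2'
  have e1 : p / s ^ 2 * (a * s ^ 2 * M0) = a * p * M0 := by field_simp
  have key := hA a s κ τ t E (f x2) _ (‖x2 - y0‖) (‖x2 - y‖) ha hs hsn hκ hτ hτ1 ht0 ht11
    (by rw [hE, hts]; congr 2; field_simp) hc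
    ((norm_sub_le _ _).trans (by linarith)) ((norm_sub_le _ _).trans (by linarith)) (by
      refine hf.trans (le_of_eq ?_)
      rw [hts]
      field_simp)
  rw [← ht]
  have h1 : κ * (lam / 1248) * τ ≤ (|f x2| + C3 * a * cutg t) * τ :=
    mul_le_mul_of_nonneg_right key hτ.le
  have h2 : κ * (lam / 1248) * τ = dist y yb * (lam * a / 1248) := by
    rw [dist_comm, dist_eq_norm]
    linear_combination (lam / 1248) * hκτ
  rw [h2, ← le_div_iff₀ (by positivity)] at h1
  refine h1.trans (le_of_eq ?_)
  field_simp

lemma pow_three_le (A B C : ℝ≥0∞) (m : ℕ) : (A + B + C) ^ m ≤ 3 ^ m * (A ^ m + B ^ m + C ^ m) := by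
  have h : A + B + C ≤ 3 * max (max A B) C := by
    have h1 : A ≤ max (max A B) C := (le_max_left _ _).trans (le_max_left _ _)
    have h2 : B ≤ max (max A B) C := (le_max_right _ _).trans (le_max_left _ _)
    have h3 : C ≤ max (max A B) C := le_max_right _ _
    calc A + B + C ≤ max (max A B) C + max (max A B) C + max (max A B) C := by gcongr
      _ = 3 * max (max A B) C := by ring
  refine (pow_le_pow_left' h m).trans ?_
  rw [mul_pow]
  refine mul_le_mul_right ?_ _
  rcases max_choice (max A B) C with e | e <;> rw [e]
  · rcases max_choice A B with e | e <;> rw [e]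
    · rw [add_assoc]; exact le_self_add
    · rw [add_comm (A ^ m), add_assoc]; exact le_self_add
  · exact le_add_self

end GrowthPair

section GrowthMain
variable {d : ℕ}

lemma vol_cb (x : Ed d) {s : ℝ} (hs : 0 ≤ s) :
    volume (closedBall x s) = ENNReal.ofReal s ^ d * volume (ball (0 : Ed d) 1) := by
  rw [Measure.addHaar_closedBall _ _ hs, finrank_euclideanSpace_fin, ENNReal.ofReal_pow hs]

lemma vol_cb_mul (x y : Ed d) {s m : ℝ} (hs : 0 ≤ s) (hm : 0 ≤ m) :
    volume (closedBall x (m * s)) = ENNReal.ofReal m ^ d * volume (closedBall y s) := by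
  rw [vol_cb _ hs, vol_cb _ (by positivity), ENNReal.ofReal_mul hm, mul_pow, mul_assoc]

lemma vol_ball_eq (x : Ed d) {s : ℝ} (hs : 0 < s) : volume (ball x s) = volume (closedBall x s) := by
  rw [vol_cb _ hs.le, Measure.addHaar_ball_of_pos _ _ hs, finrank_euclideanSpace_fin,
    ENNReal.ofReal_pow hs.le]

/-- integration of the pointwise bound -/
lemma integrate_bound (hd : 1 ≤ d) {S A : Set (Ed d)} {f : Ed d → ℝ} {a s C7 C3 : ℝ} {x' : Ed d}
    (ha : 0 < a) (hs : 0 < s) (hC7 : 0 < C7) (hC3 : 0 ≤ C3)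
    (hS : S ⊆ closedBall x' (10 * s)) (hSA : S ∩ closedBall x' s ⊆ A)
    (hV : volume (ball x' (s / 2)) ≤ ∫⁻ x in S, ENNReal.ofReal
      (C7 / a * (|f x| + C3 * a * cutg (‖x - x'‖ / s) + a / (C7 * 120))) ^ d) :
    volume (closedBall x' s) ≤ (2 * 6 ^ d * (ENNReal.ofReal C7 ^ d + ENNReal.ofReal (C7 * C3) ^ d)) *
      (volume (A ∩ closedBall x' s) + ENNReal.ofReal (1 / a) ^ d *
        ∫⁻ x in closedBall x' (10 * s), ENNReal.ofReal |f x| ^ d) := by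
  have hpt : ∀ x, ENNReal.ofReal
      (C7 / a * (|f x| + C3 * a * cutg (‖x - x'‖ / s) + a / (C7 * 120))) ^ d
      ≤ 3 ^ d * ((ENNReal.ofReal C7 ^ d * ENNReal.ofReal (1 / a) ^ d * ENNReal.ofReal |f x| ^ d
        + (closedBall x' s).indicator (fun _ => ENNReal.ofReal (C7 * C3) ^ d) x)
        + ENNReal.ofReal (1 / 120) ^ d) := by
    intro x
    have hg := cutg_nonneg (‖x - x'‖ / s)
    have e : C7 / a * (|f x| + C3 * a * cutg (‖x - x'‖ / s) + a / (C7 * 120))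
        = C7 * (1 / a) * |f x| + C7 * C3 * cutg (‖x - x'‖ / s) + 1 / 120 := by field_simp
    rw [e, ENNReal.ofReal_add (by positivity) (by positivity),
      ENNReal.ofReal_add (by positivity) (by positivity)]
    refine (pow_three_le _ _ _ _).trans ?_
    refine mul_le_mul_right (add_le_add (add_le_add ?_ ?_) le_rfl) _
    · rw [ENNReal.ofReal_mul (by positivity), ENNReal.ofReal_mul (by positivity), mul_pow, mul_pow]
    · by_cases hx : x ∈ closedBall x' s
      · rw [indicator_of_mem hx]
        refine pow_le_pow_left' (ENNReal.ofReal_le_ofReal ?_) _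
        have := mul_le_mul_of_nonneg_left (cutg_le_one (‖x - x'‖ / s))
          (by positivity : 0 ≤ C7 * C3)
        linarith
      · rw [indicator_of_notMem hx, cutg_eq_zero, mul_zero, ENNReal.ofReal_zero,
          zero_pow (by omega)]
        rw [mem_closedBall, dist_eq_norm, not_le] at hx
        rw [le_div_iff₀ hs]; linarith
  have h1 := hV.trans (lintegral_mono hpt)
  rw [lintegral_const_mul' _ _ (ENNReal.pow_ne_top (by simp)),
    lintegral_add_right _ measurable_const,
    lintegral_add_right _ (measurable_const.indicator measurableSet_closedBall),
    lintegral_const_mul' _ _ (ENNReal.mul_ne_top (ENNReal.pow_ne_top ENNReal.ofReal_ne_top)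
      (ENNReal.pow_ne_top ENNReal.ofReal_ne_top)),
    lintegral_indicator measurableSet_closedBall, setLIntegral_const, setLIntegral_const,
    Measure.restrict_apply measurableSet_closedBall] at h1
  obtain ⟨V, hVd⟩ : ∃ V, V = volume (closedBall x' (s / 2)) := ⟨_, rfl⟩
  have hVtop : V ≠ ⊤ := by rw [hVd]; exact measure_closedBall_lt_top.ne
  have hVs : volume (closedBall x' s) = 2 ^ d * V := by
    have := vol_cb_mul x' x' (s := s / 2) (m := 2) (by positivity) (by norm_num)
    rw [show 2 * (s / 2) = s by ring] at this
    rw [this, hVd]; norm_num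
  have hV10 : volume S ≤ 20 ^ d * V := by
    refine (measure_mono hS).trans (le_of_eq ?_)
    have := vol_cb_mul x' x' (s := s / 2) (m := 20) (by positivity) (by norm_num)
    rw [show 20 * (s / 2) = 10 * s by ring] at this
    rw [this, hVd]; norm_num
  rw [vol_ball_eq _ (by positivity), ← hVd] at h1
  have hY : volume (closedBall x' s ∩ S) ≤ volume (A ∩ closedBall x' s) :=
    measure_mono fun z hz => ⟨hSA ⟨hz.2, hz.1⟩, hz.1⟩
  have hX : ∫⁻ x in S, ENNReal.ofReal |f x| ^ d
      ≤ ∫⁻ x in closedBall x' (10 * s), ENNReal.ofReal |f x| ^ d := lintegral_mono_set hS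
  generalize ∫⁻ x in S, ENNReal.ofReal |f x| ^ d = X0 at h1 hX
  generalize ∫⁻ x in closedBall x' (10 * s), ENNReal.ofReal |f x| ^ d = X at hX ⊢
  generalize volume (closedBall x' s ∩ S) = Y0 at h1 hY
  generalize volume (A ∩ closedBall x' s) = Y at hY ⊢
  rw [hVs]
  generalize ENNReal.ofReal C7 ^ d = c1 at h1 ⊢
  generalize ENNReal.ofReal (1 / a) ^ d = c0 at h1 ⊢
  generalize ENNReal.ofReal (C7 * C3) ^ d = c2 at h1 ⊢
  have h3 : (3 : ℝ≥0∞) ^ d * (ENNReal.ofReal (1 / 120) ^ d * volume S) ≤ V / 2 := by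
    calc (3 : ℝ≥0∞) ^ d * (ENNReal.ofReal (1 / 120) ^ d * volume S)
        ≤ 3 ^ d * (ENNReal.ofReal (1 / 120) ^ d * (20 ^ d * V)) := by gcongr
      _ = (3 * ENNReal.ofReal (1 / 120) * 20) ^ d * V := by rw [mul_pow, mul_pow]; ring
      _ = (2⁻¹) ^ d * V := by
          congr 2
          rw [show (3 : ℝ≥0∞) = ENNReal.ofReal 3 by norm_num,
            show (20 : ℝ≥0∞) = ENNReal.ofReal 20 by norm_num, ← ENNReal.ofReal_mul (by norm_num),
            ← ENNReal.ofReal_mul (by norm_num), ← ENNReal.ofReal_ofNat 2,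
            ← ENNReal.ofReal_inv_of_pos (by norm_num)]
          norm_num
      _ ≤ (2⁻¹) ^ 1 * V := by
          refine mul_le_mul_left (pow_le_pow_right_of_le_one' ?_ hd) _
          exact ENNReal.inv_le_one.2 (by norm_num)
      _ = V / 2 := by rw [pow_one, ENNReal.div_eq_inv_mul]
  have h4 : V ≤ 3 ^ d * ((c1 + c2) * (Y + c0 * X)) + V / 2 := by
    refine h1.trans ?_
    rw [mul_add]
    refine add_le_add (mul_le_mul_right ?_ _) h3
    calc c1 * c0 * X0 + c2 * Y0 ≤ c1 * (c0 * X) + c2 * Y := by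
          rw [mul_assoc]; gcongr
      _ ≤ (c1 + c2) * (Y + c0 * X) := by
          have : (c1 + c2) * (Y + c0 * X) = c1 * (c0 * X) + c2 * Y + (c1 * Y + c2 * (c0 * X)) := by
            ring
          rw [this]; exact le_self_add
  have hV2 : V / 2 ≠ ⊤ := ENNReal.div_ne_top hVtop (by norm_num)
  have h5 : V / 2 ≤ 3 ^ d * ((c1 + c2) * (Y + c0 * X)) := by
    have : V / 2 + V / 2 ≤ 3 ^ d * ((c1 + c2) * (Y + c0 * X)) + V / 2 := by
      rwa [ENNReal.add_halves]
    exact (ENNReal.add_le_add_iff_right hV2).1 this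
  calc 2 ^ d * V = 2 ^ d * (2 * (V / 2)) := by rw [ENNReal.mul_div_cancel (by norm_num) (by norm_num)]
    _ ≤ 2 ^ d * (2 * (3 ^ d * ((c1 + c2) * (Y + c0 * X)))) := by gcongr
    _ = 2 * (2 * 3) ^ d * (c1 + c2) * (Y + c0 * X) := by rw [mul_pow]; ring
    _ = 2 * 6 ^ d * (c1 + c2) * (Y + c0 * X) := by norm_num

end GrowthMain

section GrowthThm
variable {d : ℕ}

set_option maxHeartbeats 1000000 in
lemma growth (hd : 1 ≤ d) {lam Lam C0 : ℝ}
    (hlam : 0 < lam) (hLam : lam ≤ Lam) (hC0 : 0 ≤ C0)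
    {K : Ed d → ℝ} (hK : KernCond K) {n : ℝ} (hn : 1 ≤ n) :
    ∃ (M : ℝ) (Cg : ℝ≥0∞), 2 ≤ M ∧ Cg ≠ ⊤ ∧ ∀ r : ℝ, 0 < r → r ≤ 1 →
      ∀ f : Ed d → ℝ, ContinuousOn f (ball (0 : Ed d) (9 * n)) →
      ∀ u : Ed d → ℝ, LowerSemicontinuous u → IsBddFun u → (∀ x, 0 ≤ u x) →
        SupersolExtremal lam Lam C0 r K f (ball (0 : Ed d) (9 * n)) u →
      ∀ xs : Ed d, ‖xs‖ ≤ 3 * n → u xs ≤ 2 →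
      ∀ a s : ℝ, 4 ≤ a → 0 < s → s ≤ 5 / 8 * n → ∀ x' x1 : Ed d, ‖x'‖ + 11 * s < 9 * n →
        x1 ∈ Aset u (9 * n) a → dist x1 x' ≤ 9 * s →
        volume (closedBall x' s) ≤ Cg * (volume (Aset u (9 * n) (M * a) ∩ closedBall x' s) +
          ENNReal.ofReal (1 / a) ^ d * ∫⁻ x in closedBall x' (10 * s), ENNReal.ofReal |f x| ^ d) := by
  obtain ⟨p, M0, C3, δ, τ1, hp, hM0, hC3, hδ, hδ1, hτ1, hA⟩ :=
    arith_consts (D := d) (by positivity) hlam (hlam.le.trans hLam) hC0 (IK_nonneg hK) hn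
  have hp0 : 0 < p := by linarith
  refine ⟨2 + 2 * (p * M0), 2 * 6 ^ d * (ENNReal.ofReal (1248 / lam) ^ d
    + ENNReal.ofReal (1248 / lam * C3) ^ d), ?_, ?_, ?_⟩
  · have : 0 ≤ p * M0 := by positivity
    linarith
  · refine ENNReal.mul_ne_top (ENNReal.mul_ne_top (by simp) (ENNReal.pow_ne_top (by simp)))
      (ENNReal.add_ne_top.2 ⟨ENNReal.pow_ne_top ENNReal.ofReal_ne_top,
        ENNReal.pow_ne_top ENNReal.ofReal_ne_top⟩)
  intro r hr hr1 f hf u hu hub hu0 hsup xs hxs hus a s ha4 hs hsn x' x1 hx' hx1 hd1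
  have ha : 0 < a := by linarith
  obtain ⟨hx1n, y0, hy0, hcon⟩ := hx1
  have hsub2 : closedBall x' (11 * s) ⊆ ball (0 : Ed d) (9 * n) := by
    intro z hz
    rw [mem_closedBall, dist_eq_norm] at hz
    rw [mem_ball_zero_iff]
    have : ‖z‖ ≤ ‖z - x'‖ + ‖x'‖ := by
      simpa using norm_add_le (z - x') x'
    linarith
  have hcbn : ∀ y ∈ closedBall x' (11 * s), ‖y‖ ≤ 9 * n := fun y hy =>
    (mem_ball_zero_iff.1 (hsub2 hy)).le
  obtain ⟨q, hq⟩ : ∃ q, q = a * s ^ 2 * M0 := ⟨_, rfl⟩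
  obtain ⟨k, hk⟩ : ∃ k, k = p / s ^ 2 := ⟨_, rfl⟩
  have hq0 : 0 ≤ q := by rw [hq]; positivity
  have hk0 : 0 ≤ k := by rw [hk]; positivity
  have hqk : q * k = a * (p * M0) := by rw [hq, hk]; field_simp
  -- value at x1
  have hval : ∀ y ∈ closedBall x' (s / 2), ob u a q k y0 x' y x1 ≤ 91 * n ^ 2 * a := by
    intro y hy
    have h1 := hcon xs
    have h2 : ‖xs - y0‖ ^ 2 ≤ (12 * n) ^ 2 := by
      refine pow_le_pow_left₀ (norm_nonneg _) ?_ 2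
      exact (norm_sub_le _ _).trans (by linarith)
    have h3 : ‖x1 - y‖ ^ 2 ≤ (6 * n) ^ 2 := by
      refine pow_le_pow_left₀ (norm_nonneg _) ?_ 2
      rw [← dist_eq_norm]
      rw [mem_closedBall, dist_comm] at hy
      have := dist_triangle x1 x' y
      linarith
    have h4 := mul_le_mul_of_nonneg_left h2 (by positivity : 0 ≤ a / 2)
    have h5 := mul_le_mul_of_nonneg_left h3 (by positivity : 0 ≤ a / 2)
    have h6 : 0 ≤ q * Real.exp (-(k * ‖x1 - x'‖ ^ 2)) := mul_nonneg hq0 (Real.exp_pos _).le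
    have h7 : 4 * 1 ≤ a * n ^ 2 := mul_le_mul ha4 (one_le_pow₀ hn) (by norm_num) ha.le
    unfold ob
    linarith
  -- the set of contact points
  obtain ⟨S, hS⟩ : ∃ S : Set (Ed d), S = {x | x ∈ closedBall x' (10 * s) ∧
    ∃ y ∈ closedBall x' (s / 2), ∀ z, ob u a q k y0 x' y x ≤ ob u a q k y0 x' y z} := ⟨_, rfl⟩
  have hScomp : IsCompact S := by
    have := isCompact_contact hu (g := fun x y => a / 2 * ‖x - y0‖ ^ 2 + a / 2 * ‖x - y‖ ^ 2
      - q * Real.exp (-(k * ‖x - x'‖ ^ 2)))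
      (by simp only [Function.uncurry_def]; fun_prop)
      (isCompact_closedBall x' (10 * s)) (isCompact_closedBall x' (s / 2))
    have hob : ∀ y z, ob u a q k y0 x' y z = u z + (a / 2 * ‖z - y0‖ ^ 2 + a / 2 * ‖z - y‖ ^ 2
      - q * Real.exp (-(k * ‖z - x'‖ ^ 2))) := fun y z => by unfold ob; ring
    rw [hS]
    simpa only [hob] using this
  have hS10 : S ⊆ closedBall x' (10 * s) := by rw [hS]; exact fun x hx => hx.1
  have h1011 : closedBall x' (10 * s) ⊆ closedBall x' (11 * s) :=
    closedBall_subset_closedBall (by linarith)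
  have hSA : S ∩ closedBall x' s ⊆ Aset u (9 * n) ((2 + 2 * (p * M0)) * a) := by
    rintro x ⟨hx, -⟩
    have hx10 := hS10 hx
    rw [hS] at hx
    obtain ⟨-, y, hy, hc⟩ := hx
    refine contact_mem_Aset ha hq0 hk0 hqk rfl hc (hcbn x (h1011 hx10)) hy0 (hcbn y ?_)
      (hcbn x' (mem_closedBall_self (by positivity)))
    exact closedBall_subset_closedBall (by linarith) hy
  refine integrate_bound hd ha hs (by positivity) hC3 hS10 hSA ?_
  have hF : ContinuousOn (fun x => |f x| + C3 * a * cutg (‖x - x'‖ / s)) (closedBall x' (11 * s)) := by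
    refine ((hf.mono hsub2).abs).add (Continuous.continuousOn ?_)
    have := continuous_cutg
    fun_prop
  have hm := measure_lemma (E := ball x' (s / 2)) hScomp (isCompact_closedBall x' (11 * s))
    (hS10.trans h1011)
    (Rel := fun x y => y ∈ closedBall x' (s / 2) ∧
      ∀ z, ob u a q k y0 x' y x ≤ ob u a q k y0 x' y z) (by
      intro y hy
      have hy' := ball_subset_closedBall hy
      have hx1m : x1 ∈ closedBall x' (10 * s) := by rw [mem_closedBall]; linarith
      obtain ⟨x, hx, hmin⟩ := exists_global_min (ob_lsc hu a q k y0 x' y) hx1m (by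
        intro z hz
        rw [mem_closedBall, not_le] at hz
        rw [mem_closedBall] at hy'
        have h1 := hcon z
        have h2 : ‖x1 - y‖ ^ 2 ≤ ‖z - y‖ ^ 2 := by
          refine pow_le_pow_left₀ (norm_nonneg _) ?_ 2
          rw [← dist_eq_norm, ← dist_eq_norm]
          have e1 := dist_triangle x1 x' y
          have e2 := dist_triangle z y x'
          rw [dist_comm x' y] at e1
          linarith
        have h3 : ‖x1 - x'‖ ^ 2 ≤ ‖z - x'‖ ^ 2 := by
          refine pow_le_pow_left₀ (norm_nonneg _) ?_ 2
          rw [← dist_eq_norm, ← dist_eq_norm]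
          linarith
        have h4 : Real.exp (-(k * ‖z - x'‖ ^ 2)) ≤ Real.exp (-(k * ‖x1 - x'‖ ^ 2)) := by
          apply Real.exp_le_exp.2
          have := mul_le_mul_of_nonneg_left h3 hk0
          linarith
        have h5 := mul_le_mul_of_nonneg_left h4 hq0
        have h6 := mul_le_mul_of_nonneg_left h2 (by positivity : 0 ≤ a / 2)
        unfold ob
        linarith)
      exact ⟨x, hS ▸ ⟨hx, y, hy', hmin⟩, hy', hmin⟩)
    hF (fun x => by
      have := cutg_nonneg (‖x - x'‖ / s)
      positivity) (L := 1248 / (lam * a)) (H := δ⁻¹) (τ1 := min τ1 (δ * s)) (by positivity)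
    (by positivity) (by positivity) (by
      intro x0 hx0 xb hxb y yb hy hyb τ hτ hττ hxx
      have hx010 := hS10 hx0
      subst hq hk
      exact growth_pair hlam hLam hC0 hK hr hr1 hu hu0 hub hsup hp hM0 hC3 hδ hδ1 hA ha hs
        (by linarith) hx' hy0 (hcbn y (closedBall_subset_closedBall (by linarith) hy.1)) hy.2 hyb.2
        ((hy.2 x1).trans (hval y hy.1)) hx010 hτ (hττ.trans (min_le_left _ _))
        (hττ.trans (min_le_right _ _)) hxx)
    (ε := a / (1248 / lam * 120)) (by positivity)
  refine hm.trans (le_of_eq ?_)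
  rw [div_div]

end GrowthThm

section Covering
variable {d : ℕ}

lemma covering {n : ℝ} (hn : 1 ≤ n) {A A' : Set (Ed d)} (hA : IsCompact A) (hA' : MeasurableSet A')
    {x1 : Ed d} (hx1 : x1 ∈ A) (hx1n : ‖x1‖ ≤ 4 * n) {Cg c : ℝ≥0∞} {G : Ed d → ℝ≥0∞}
    (hg : ∀ s, 0 < s → s ≤ 5 / 8 * n → ∀ x' x1 : Ed d, ‖x'‖ + 11 * s < 9 * n → x1 ∈ A →
      dist x1 x' ≤ 9 * s → volume (closedBall x' s) ≤
        Cg * (volume (A' ∩ closedBall x' s) + c * ∫⁻ x in closedBall x' (10 * s), G x)) :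
    volume (closedBall (0 : Ed d) n \ A) ≤ 50 ^ d * Cg *
      (volume ((closedBall (0 : Ed d) n \ A) ∩ A') + c * ∫⁻ x in ball (0 : Ed d) (9 * n), G x) := by
  obtain ⟨t, ht⟩ : ∃ t, t = closedBall (0 : Ed d) n \ A := ⟨_, rfl⟩
  rw [← ht]
  have key : ∀ x ∈ t, ∃ (s : ℝ) (x' : Ed d), 0 < s ∧ s ≤ 5 / 8 * n ∧ dist x x' ≤ s ∧
      ‖x'‖ ≤ n - s ∧ closedBall x' s ⊆ t ∧ ∃ p ∈ A, dist p x' ≤ 9 * s := by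
    intro x hx
    rw [ht] at hx
    obtain ⟨hxn, hxA⟩ := hx
    rw [mem_closedBall, dist_zero_right] at hxn
    have hpos : 0 < infDist x A := (hA.isClosed.notMem_iff_infDist_pos ⟨x1, hx1⟩).1 hxA
    obtain ⟨p, hp, hpd⟩ := hA.exists_infDist_eq_dist ⟨x1, hx1⟩ x
    have h5 : infDist x A ≤ 5 * n := by
      refine (infDist_le_dist_of_mem hx1).trans ?_
      rw [dist_eq_norm]
      have := norm_sub_le x x1
      linarith
    obtain ⟨s, hs⟩ : ∃ s, s = infDist x A / 8 := ⟨_, rfl⟩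
    have hs0 : 0 < s := by rw [hs]; positivity
    have hsn : s ≤ 5 / 8 * n := by rw [hs]; linarith
    have hn0 : 0 < n := by linarith
    have hsn1 : s / n ≤ 1 := by rw [div_le_one hn0]; linarith
    have hdx : dist x ((1 - s / n) • x) ≤ s := by
      rw [dist_eq_norm, sub_smul, one_smul, sub_sub_cancel, norm_smul, Real.norm_of_nonneg (by positivity)]
      calc s / n * ‖x‖ ≤ s / n * n := by gcongr
        _ = s := by field_simp
    have hnx : ‖(1 - s / n) • x‖ ≤ n - s := by
      rw [norm_smul, Real.norm_of_nonneg (by linarith)]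
      calc (1 - s / n) * ‖x‖ ≤ (1 - s / n) * n := mul_le_mul_of_nonneg_left hxn (by linarith)
        _ = n - s := by field_simp
    refine ⟨s, (1 - s / n) • x, hs0, hsn, hdx, hnx, ?_, p, hp, ?_⟩
    · intro z hz
      rw [mem_closedBall] at hz
      rw [ht]
      constructor
      · rw [mem_closedBall, dist_zero_right]
        have e : z = (z - (1 - s / n) • x) + (1 - s / n) • x := by abel
        have := norm_add_le (z - (1 - s / n) • x) ((1 - s / n) • x)
        rw [← e, ← dist_eq_norm] at this
        linarith
      · intro hzA
        have h1 := infDist_le_dist_of_mem (x := x) hzA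
        have h2 := dist_triangle x ((1 - s / n) • x) z
        rw [dist_comm ((1 - s / n) • x) z] at h2
        linarith
    · have h2 := dist_triangle p x ((1 - s / n) • x)
      rw [dist_comm p x, ← hpd] at h2
      linarith
  choose! s x' hs0 hsn hxx hx'n hsub p hp hpd using key
  obtain ⟨v, hvt, hvd, hvc⟩ := Vitali.exists_disjoint_subfamily_covering_enlargement_closedBall t x'
    (fun x => 10 * s x) (10 * n) (fun x hx => by have := hsn x hx; linarith) 5 (by norm_num)
  have hcount : v.Countable := by
    refine hvd.countable_of_nonempty_interior fun x hx => ?_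
    exact (nonempty_ball.2 (by have := hs0 x (hvt hx); linarith)).mono ball_subset_interior_closedBall
  have hsubb : ∀ x ∈ v, closedBall (x' x) (s x) ⊆ closedBall (x' x) (10 * s x) := fun x hx =>
    closedBall_subset_closedBall (by have := hs0 x (hvt hx); linarith)
  have hvd2 : v.PairwiseDisjoint fun x => A' ∩ closedBall (x' x) (s x) := by
    intro a ha b hb hab
    exact (hvd ha hb hab).mono (inter_subset_right.trans (hsubb a ha))
      (inter_subset_right.trans (hsubb b hb))
  have hcov : t ⊆ ⋃ x ∈ v, closedBall (x' x) (50 * s x) := by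
    intro x hx
    obtain ⟨b, hb, hbb⟩ := hvc x hx
    refine mem_biUnion hb ?_
    have := hbb (show x ∈ closedBall (x' x) (10 * s x) by
      rw [mem_closedBall]; have := hxx x hx; have := hs0 x hx; linarith)
    rw [← mul_assoc] at this
    norm_num at this ⊢
    exact this
  have hterm : ∀ x : v, volume (closedBall (x' x) (50 * s x)) ≤ 50 ^ d * Cg *
      (volume (A' ∩ closedBall (x' x) (s x)) + c * ∫⁻ z in closedBall (x' x) (10 * s x), G z) := by
    intro x
    have hxt := hvt x.2
    have := hg (s x) (hs0 x hxt) (hsn x hxt) (x' x) (p x)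
      (by have := hx'n x hxt; have := hsn x hxt; linarith) (hp x hxt) (hpd x hxt)
    rw [vol_cb_mul _ (x' x) (hs0 x hxt).le (by norm_num), mul_assoc]
    have e50 : ENNReal.ofReal 50 = 50 := by norm_num
    rw [e50]
    gcongr
  calc volume t ≤ volume (⋃ x ∈ v, closedBall (x' x) (50 * s x)) := measure_mono hcov
    _ ≤ ∑' x : v, volume (closedBall (x' x) (50 * s x)) := measure_biUnion_le _ hcount _
    _ ≤ ∑' x : v, 50 ^ d * Cg * (volume (A' ∩ closedBall (x' x) (s x)) +
          c * ∫⁻ z in closedBall (x' x) (10 * s x), G z) := ENNReal.tsum_le_tsum hterm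
    _ = 50 ^ d * Cg * ((∑' x : v, volume (A' ∩ closedBall (x' x) (s x))) +
          c * ∑' x : v, ∫⁻ z in closedBall (x' x) (10 * s x), G z) := by
        rw [ENNReal.tsum_mul_left, ENNReal.tsum_add, ENNReal.tsum_mul_left]
    _ = 50 ^ d * Cg * (volume (⋃ x ∈ v, A' ∩ closedBall (x' x) (s x)) +
          c * ∫⁻ z in ⋃ x ∈ v, closedBall (x' x) (10 * s x), G z) := by
        rw [measure_biUnion hcount hvd2 (fun x _ => hA'.inter measurableSet_closedBall),
          lintegral_biUnion hcount (fun x _ => measurableSet_closedBall) hvd]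
    _ ≤ _ := by
        gcongr
        · refine iUnion₂_subset fun x hx => ?_
          exact fun z hz => ⟨hsub x (hvt hx) hz.2, hz.1⟩
        · refine iUnion₂_subset fun x hx => ?_
          intro z hz
          rw [mem_closedBall] at hz
          rw [mem_ball]
          have h1 := dist_triangle z (x' x) 0
          rw [dist_zero_right (x' x)] at h1
          have := hx'n x (hvt hx)
          have := hsn x (hvt hx)
          linarith

end Covering

section Iter
variable {d : ℕ}

lemma decay_seq {m : ℕ → ℝ} {Γ B : ℝ} (hΓ : 2 ≤ Γ) (h0 : m 0 ≤ B) (hB : 2 * Γ ≤ B)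
    (h : ∀ k, m k ≤ Γ * (m k - m (k + 1) + (1 / 2) ^ k)) (k : ℕ) :
    m k ≤ B * (1 - 1 / (2 * Γ)) ^ k := by
  have hΓ0 : 0 < Γ := by linarith
  have hinv : 1 / (2 * Γ) ≤ 1 / 2 := by
    apply one_div_le_one_div_of_le <;> linarith
  obtain ⟨w, hw⟩ : ∃ w, w = 1 / (2 * Γ) := ⟨_, rfl⟩
  have hwΓ : Γ * (2 * w) = 1 := by rw [hw]; field_simp
  have hw0 : 0 < w := by rw [hw]; positivity
  rw [← hw] at hinv ⊢
  induction k with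
  | zero => simpa using h0
  | succ k ih =>
    have h1 := h k
    have h2 : m (k + 1) ≤ (1 - 2 * w) * m k + (1 / 2) ^ k := by
      have := mul_le_mul_of_nonneg_left h1 (by positivity : 0 ≤ 2 * w)
      have e : 2 * w * (Γ * (m k - m (k + 1) + (1 / 2) ^ k)) = m k - m (k + 1) + (1 / 2) ^ k := by
        linear_combination (m k - m (k + 1) + (1 / 2) ^ k) * hwΓ
      linarith
    have h3 : ((1 : ℝ) / 2) ^ k ≤ (1 - w) ^ k := pow_le_pow_left₀ (by norm_num) (by linarith) k
    have h4 : 1 ≤ B * w := by nlinarith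
    have h5 : (1 - 2 * w) * m k ≤ (1 - 2 * w) * (B * (1 - w) ^ k) :=
      mul_le_mul_of_nonneg_left ih (by linarith)
    have h6 : (1 - w) ^ k ≤ (B * w) * (1 - w) ^ k :=
      le_mul_of_one_le_left (pow_nonneg (by linarith) _) h4
    rw [pow_succ]
    nlinarith

lemma iter {n M Γ : ℝ} {Cg : ℝ≥0∞} (hd : 1 ≤ d) (hn : 1 ≤ n) (hM : 2 ≤ M) (hΓ : 2 ≤ Γ)
    (hCg : 50 ^ d * Cg ≤ ENNReal.ofReal Γ)
    {u : Ed d → ℝ} (hu : LowerSemicontinuous u) (hu0 : ∀ x, 0 ≤ u x) {xs : Ed d}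
    (hxs : ‖xs‖ ≤ 3 * n) (hxs2 : u xs ≤ 2) {G : Ed d → ℝ≥0∞}
    (hG : ∫⁻ x in ball (0 : Ed d) (9 * n), G x ≤ 1)
    (hg : ∀ a s, 4 ≤ a → 0 < s → s ≤ 5 / 8 * n → ∀ x' x1 : Ed d, ‖x'‖ + 11 * s < 9 * n →
      x1 ∈ Aset u (9 * n) a → dist x1 x' ≤ 9 * s → volume (closedBall x' s) ≤
        Cg * (volume (Aset u (9 * n) (M * a) ∩ closedBall x' s) +
          ENNReal.ofReal (1 / a) ^ d * ∫⁻ x in closedBall x' (10 * s), G x)) (k : ℕ) :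
    volume (closedBall (0 : Ed d) n \ Aset u (9 * n) (4 * M ^ k)) ≤
      ENNReal.ofReal ((max (volume (closedBall (0 : Ed d) n)).toReal (2 * Γ)) *
        (1 - 1 / (2 * Γ)) ^ k) := by
  have hM0 : 0 < M := by linarith
  have hfin : ∀ T : Set (Ed d), volume (closedBall (0 : Ed d) n \ T) ≠ ⊤ := fun T =>
    ((measure_mono diff_subset).trans_lt measure_closedBall_lt_top).ne
  have hak : ∀ k : ℕ, (4 : ℝ) ≤ 4 * M ^ k := fun k => by
    have := one_le_pow₀ (n := k) (by linarith : 1 ≤ M)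
    linarith
  rw [← ENNReal.ofReal_toReal (hfin (Aset u (9 * n) (4 * M ^ k)))]
  apply ENNReal.ofReal_le_ofReal
  refine decay_seq (m := fun k =>
    (volume (closedBall (0 : Ed d) n \ Aset u (9 * n) (4 * M ^ k))).toReal) hΓ ?_
    (le_max_right _ _) ?_ k
  · refine le_trans ?_ (le_max_left _ _)
    exact ENNReal.toReal_mono measure_closedBall_lt_top.ne (measure_mono diff_subset)
  intro k
  obtain ⟨a, ha⟩ : ∃ a, a = 4 * M ^ k := ⟨_, rfl⟩
  have ha4 : 4 ≤ a := ha ▸ hak k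
  have ea : 4 * M ^ (k + 1) = M * a := by rw [ha, pow_succ]; ring
  simp only [ea, ← ha]
  -- a point of A_a
  obtain ⟨x1, hx1, hmin⟩ := exists_global_min (w := fun z => u z + a / 2 * ‖z - xs‖ ^ 2)
    (x0 := xs) (p := xs) (R := 1)
    (hu.add (Continuous.lowerSemicontinuous (by fun_prop))) (mem_closedBall_self (by norm_num)) (by
      intro z hz
      rw [mem_closedBall, not_le, dist_eq_norm] at hz
      have h1 : 1 ≤ ‖z - xs‖ ^ 2 := by nlinarith
      have h2 := hu0 z
      simp only [sub_self, norm_zero]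
      nlinarith)
  rw [mem_closedBall, dist_eq_norm] at hx1
  have hx1n : ‖x1‖ ≤ 4 * n := by
    have := norm_add_le (x1 - xs) xs
    rw [sub_add_cancel] at this
    linarith
  have hx1A : x1 ∈ Aset u (9 * n) a := ⟨by linarith, xs, by linarith, hmin⟩
  have hc := covering hn (isCompact_Aset hu (9 * n) a)
    (isCompact_Aset hu (9 * n) (M * a)).measurableSet hx1A hx1n (fun s => hg a s ha4)
  have hmono : Aset u (9 * n) a ⊆ Aset u (9 * n) (M * a) :=
    Aset_mono (by linarith) (by linarith)
  have hadd := measure_inter_add_diff (μ := volume) (closedBall (0 : Ed d) n \ Aset u (9 * n) a)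
    (isCompact_Aset hu (9 * n) (M * a)).measurableSet
  rw [diff_diff, union_eq_self_of_subset_left hmono] at hadd
  obtain ⟨X, hX⟩ : ∃ X, X = volume ((closedBall (0 : Ed d) n \ Aset u (9 * n) a) ∩
    Aset u (9 * n) (M * a)) := ⟨_, rfl⟩
  rw [← hX] at hc hadd
  have hXtop : X ≠ ⊤ := by
    intro h
    rw [h, top_add] at hadd
    exact hfin _ hadd.symm
  have hreal := congrArg ENNReal.toReal hadd
  rw [ENNReal.toReal_add hXtop (hfin _)] at hreal
  have hpow : ENNReal.ofReal (1 / a) ^ d * ∫⁻ x in ball (0 : Ed d) (9 * n), G x ≤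
      ENNReal.ofReal ((1 / 2) ^ k) := by
    have h1 : ENNReal.ofReal (1 / a) ≤ 1 := by
      rw [ENNReal.ofReal_le_one, div_le_one (by linarith)]; linarith
    calc _ ≤ ENNReal.ofReal (1 / a) ^ 1 * 1 :=
          mul_le_mul' (pow_le_pow_right_of_le_one' h1 hd) hG
      _ ≤ _ := by
          rw [pow_one, mul_one]
          apply ENNReal.ofReal_le_ofReal
          rw [one_div_pow]
          apply one_div_le_one_div_of_le (by positivity)
          have := pow_le_pow_left₀ (by norm_num) hM k
          rw [ha]
          have : 0 < M ^ k := by positivity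
          linarith
  have hc2 : volume (closedBall (0 : Ed d) n \ Aset u (9 * n) a) ≤
      ENNReal.ofReal (Γ * (X.toReal + (1 / 2) ^ k)) := by
    refine hc.trans ?_
    rw [ENNReal.ofReal_mul (by linarith), ENNReal.ofReal_add (by positivity) (by positivity),
      ENNReal.ofReal_toReal hXtop]
    exact mul_le_mul' hCg (add_le_add le_rfl hpow)
  have hc3 := ENNReal.toReal_le_of_le_ofReal (by positivity) hc2
  have : X.toReal = (volume (closedBall (0 : Ed d) n \ Aset u (9 * n) a)).toReal -
    (volume (closedBall (0 : Ed d) n \ Aset u (9 * n) (M * a))).toReal := by linarith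
  rw [this] at hc3
  exact hc3

lemma GSet_mono (u : Ed d → ℝ) {s t : ℝ} (h : s ≤ t) : GSet u s ⊆ GSet u t := by
  rintro x ⟨ρ, hρ, A, C, B, h1, h2⟩
  exact ⟨ρ, hρ, A, C, B, h1.trans h, h2⟩

lemma Aset_sub_GSet {n a : ℝ} (hn : 1 ≤ n) (ha : 4 ≤ a) {u : Ed d → ℝ} (hu0 : ∀ x, 0 ≤ u x)
    {xs : Ed d} (hxs : ‖xs‖ ≤ 3 * n) (hxs2 : u xs ≤ 2) {x : Ed d} (hx : x ∈ Aset u (9 * n) a) :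
    x ∈ GSet u (92 * n ^ 2 * a) := by
  obtain ⟨hxn, y, hy, hmin⟩ := hx
  have hxy : ‖x - y‖ ≤ 18 * n := (norm_sub_le _ _).trans (by linarith)
  have hxsy : ‖xs - y‖ ≤ 12 * n := (norm_sub_le _ _).trans (by linarith)
  have hux : u x ≤ 2 + a / 2 * (12 * n) ^ 2 := by
    have h1 := hmin xs
    have h2 : a / 2 * ‖xs - y‖ ^ 2 ≤ a / 2 * (12 * n) ^ 2 := by gcongr
    have h3 : 0 ≤ a / 2 * ‖x - y‖ ^ 2 := by positivity
    linarith
  refine ⟨1, one_pos, u x, a, -(a • (x - y)), ?_, rfl, ?_⟩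
  · rw [abs_of_nonneg (hu0 x), abs_of_nonneg (by linarith : 0 ≤ a), norm_neg, norm_smul,
      Real.norm_of_nonneg (by linarith)]
    have h4 : a * ‖x - y‖ ≤ a * (18 * n) := mul_le_mul_of_nonneg_left hxy (by linarith)
    have h5 : n ≤ n ^ 2 := by nlinarith
    have h6 : a * n ≤ a * n ^ 2 := mul_le_mul_of_nonneg_left h5 (by linarith)
    have h7 : a ≤ a * n ^ 2 := by nlinarith
    nlinarith
  · intro z _
    have h1 := hmin z
    have e : ‖z - y‖ ^ 2 = ‖z - x‖ ^ 2 + 2 * ⟪x - y, z - x⟫ + ‖x - y‖ ^ 2 := by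
      have : z - y = (z - x) + (x - y) := by abel
      rw [this, norm_add_sq_real, real_inner_comm]
    rw [inner_neg_left, real_inner_smul_left]
    rw [e] at h1
    nlinarith

lemma cube_one_sub : cube d 1 ⊆ closedBall (0 : Ed d) (Real.sqrt d) := by
  intro x hx
  rw [mem_closedBall, dist_zero_right, EuclideanSpace.norm_eq]
  apply Real.sqrt_le_sqrt
  calc ∑ i, ‖x i‖ ^ 2 ≤ ∑ _i : Fin d, (1 : ℝ) := by
        refine Finset.sum_le_sum fun i _ => ?_
        have h := hx i
        simp only [PiLp.zero_apply, sub_zero] at h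
        rw [Real.norm_eq_abs]
        have := abs_nonneg (x i)
        nlinarith
    _ = d := by simp

lemma cube_three_norm {x : Ed d} (hx : x ∈ cube d 3) : ‖x‖ ≤ 3 * Real.sqrt d := by
  have h : ‖((1 : ℝ) / 3) • x‖ ≤ Real.sqrt d := by
    have := cube_one_sub (d := d) (show ((1 : ℝ) / 3) • x ∈ cube d 1 from fun i => by
      have h := hx i
      simp only [PiLp.zero_apply, sub_zero] at h
      simp only [PiLp.smul_apply, smul_eq_mul, PiLp.zero_apply, sub_zero, abs_mul]
      rw [abs_of_pos (by norm_num : (0 : ℝ) < 1 / 3)]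
      linarith)
    rwa [mem_closedBall, dist_zero_right] at this
  rw [norm_smul, Real.norm_of_nonneg (by norm_num)] at h
  linarith

lemma lint_le_one (hd : 1 ≤ d) {S : Set (Ed d)} {f : Ed d → ℝ}
    (hfInt : IntegrableOn (fun x => |f x| ^ (d : ℝ)) S) (h : LnormOn (d : ℝ) S f ≤ 1) :
    ∫⁻ x in S, ENNReal.ofReal |f x| ^ d ≤ 1 := by
  have h1 : ∫ x in S, |f x| ^ (d : ℝ) ≤ 1 := by
    by_contra hc
    rw [not_le] at hc
    have : 1 < LnormOn (d : ℝ) S f := Real.one_lt_rpow hc (by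
      have : (0 : ℝ) < d := by exact_mod_cast hd
      positivity)
    linarith
  have e : ∀ x, ENNReal.ofReal |f x| ^ d = ENNReal.ofReal (|f x| ^ (d : ℝ)) := fun x => by
    rw [Real.rpow_natCast, ENNReal.ofReal_pow (abs_nonneg _)]
  simp only [e]
  rw [← ofReal_integral_eq_lintegral_ofReal hfInt (Filter.Eventually.of_forall fun x => by positivity)]
  exact ENNReal.ofReal_le_one.2 h1

end Iter

/-- power decay of the bad sets (Lemma 3.8). -/
theorem bad_set_power_decay {d : ℕ} (hd : 1 ≤ d) (lam Lam C0 : ℝ)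
    (hlam : 0 < lam) (hLam : lam ≤ Lam) (hC0 : 0 ≤ C0)
    (K : Ed d → ℝ) (hK : KernCond K) :
    ∃ ε₁ ε₂ C : ℝ, 0 < ε₁ ∧ 0 < ε₂ ∧ 0 < C ∧
      ∀ r : ℝ, 0 < r → r ≤ 1 →
      ∀ f : Ed d → ℝ, ContinuousOn f (Metric.ball (0 : Ed d) (9 * Real.sqrt d)) →
        IntegrableOn (fun x => |f x| ^ (d : ℝ)) (Metric.ball (0 : Ed d) (9 * Real.sqrt d)) →
        LnormOn (d : ℝ) (Metric.ball (0 : Ed d) (9 * Real.sqrt d)) f ≤ ε₁ →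
      ∀ u : Ed d → ℝ, LowerSemicontinuous u → IsBddFun u → (∀ x, 0 ≤ u x) →
        SupersolExtremal lam Lam C0 r K f (Metric.ball (0 : Ed d) (9 * Real.sqrt d)) u →
        sInf (u '' cube d 3) ≤ 1 →
        ∀ t : ℝ, 0 < t →
          volume (cube d 1 ∩ BSet u t) ≤ ENNReal.ofReal (C * t ^ (-ε₂)) := by
  have hn : 1 ≤ Real.sqrt d := by
    rw [Real.one_le_sqrt]; exact_mod_cast hd
  obtain ⟨M, Cg, hM, hCg, hgr⟩ := growth hd hlam hLam hC0 hK hn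
  obtain ⟨n, hnd⟩ : ∃ n, n = Real.sqrt d := ⟨_, rfl⟩
  have hcs := cube_one_sub (d := d)
  have hc3 : ∀ x ∈ cube d 3, ‖x‖ ≤ 3 * n := fun x hx => by rw [hnd]; exact cube_three_norm hx
  rw [← hnd] at hn hgr hcs ⊢
  obtain ⟨Γ, hΓd⟩ : ∃ Γ, Γ = max 2 (50 ^ d * Cg).toReal := ⟨_, rfl⟩
  have hΓ : 2 ≤ Γ := hΓd ▸ le_max_left _ _
  have hCgΓ : 50 ^ d * Cg ≤ ENNReal.ofReal Γ := by
    rw [hΓd]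
    refine le_trans ?_ (ENNReal.ofReal_le_ofReal (le_max_right _ _))
    rw [ENNReal.ofReal_toReal]
    exact ENNReal.mul_ne_top (ENNReal.pow_ne_top (by norm_num)) hCg
  obtain ⟨B, hBd⟩ : ∃ B, B = max (volume (closedBall (0 : Ed d) n)).toReal (2 * Γ) := ⟨_, rfl⟩
  have hB0 : 0 < B := lt_of_lt_of_le (by linarith) (hBd ▸ le_max_right _ _)
  obtain ⟨θ, hθd⟩ : ∃ θ, θ = 1 - 1 / (2 * Γ) := ⟨_, rfl⟩
  have hw0 : 0 < 1 / (2 * Γ) := by positivity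
  have hw1 : 1 / (2 * Γ) < 1 := by rw [div_lt_one] <;> linarith
  have hθ0 : 0 < θ := by linarith
  have hθ1 : θ < 1 := by linarith
  have hM0 : 0 < M := by linarith
  have hlogM : 0 < Real.log M := Real.log_pos (by linarith)
  obtain ⟨e2, he2⟩ : ∃ e2, e2 = -Real.log θ / Real.log M := ⟨_, rfl⟩
  have he20 : 0 < e2 := by
    rw [he2]; have := Real.log_neg hθ0 hθ1; apply div_pos <;> linarith
  have hθM : M ^ (-e2) = θ := by
    rw [Real.rpow_def_of_pos hM0, he2]
    rw [show Real.log M * -(-Real.log θ / Real.log M) = Real.log θ by field_simp, Real.exp_log hθ0]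
  obtain ⟨D, hD⟩ : ∃ D, D = 4 * (92 * n ^ 2) := ⟨_, rfl⟩
  have hD0 : 0 < D := by rw [hD]; positivity
  refine ⟨1, e2, B / θ * D ^ e2, one_pos, he20, by positivity, ?_⟩
  intro r hr hr1 f hf hfInt hfn u hu hub hu0 hsup hinf t ht
  obtain ⟨_, ⟨xs, hxs3, rfl⟩, hxs2⟩ := exists_lt_of_csInf_lt
    (⟨u 0, 0, fun i => by simp, rfl⟩ : (u '' cube d 3).Nonempty) (hinf.trans_lt one_lt_two)
  have hxsn := hc3 xs hxs3
  have hit := iter hd hn hM hΓ hCgΓ hu hu0 hxsn hxs2.le (lint_le_one hd hfInt hfn)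
    (hgr r hr hr1 f hf u hu hub hu0 hsup xs hxsn hxs2.le)
  rw [← hBd, ← hθd] at hit
  have hvB : volume (closedBall (0 : Ed d) n) ≤ ENNReal.ofReal B := by
    rw [hBd]
    refine le_trans ?_ (ENNReal.ofReal_le_ofReal (le_max_left _ _))
    rw [ENNReal.ofReal_toReal measure_closedBall_lt_top.ne]
  have hrw : B / θ * D ^ e2 * t ^ (-e2) = B / θ * (t / D) ^ (-e2) := by
    rw [Real.div_rpow ht.le hD0.le, Real.rpow_neg hD0.le]
    field_simp
  rw [hrw]
  by_cases htD : t / D < 1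
  · calc volume (cube d 1 ∩ BSet u t) ≤ volume (closedBall (0 : Ed d) n) :=
          measure_mono (inter_subset_left.trans hcs)
      _ ≤ ENNReal.ofReal B := hvB
      _ ≤ _ := by
          apply ENNReal.ofReal_le_ofReal
          have h1 : 1 ≤ (t / D) ^ (-e2) :=
            Real.one_le_rpow_of_pos_of_le_one_of_nonpos (by positivity) htD.le (by linarith)
          have h2 : B ≤ B / θ := by rw [le_div_iff₀ hθ0]; nlinarith
          nlinarith
  · rw [not_lt] at htD
    obtain ⟨k, hk1, hk2⟩ := exists_nat_pow_near htD (by linarith : 1 < M)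
    calc volume (cube d 1 ∩ BSet u t)
        ≤ volume (closedBall (0 : Ed d) n \ Aset u (9 * n) (4 * M ^ k)) := by
          refine measure_mono ?_
          rintro x ⟨hx1, hx2⟩
          refine ⟨hcs hx1, fun hxA => hx2 ?_⟩
          refine GSet_mono u ?_ (Aset_sub_GSet hn ?_ hu0 hxsn hxs2.le hxA)
          · rw [le_div_iff₀ hD0, hD] at hk1
            linarith
          · have := one_le_pow₀ (n := k) (by linarith : 1 ≤ M)
            linarith
      _ ≤ ENNReal.ofReal (B * θ ^ k) := hit k
      _ ≤ _ := by
          apply ENNReal.ofReal_le_ofReal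
          have h1 : (M ^ (k + 1)) ^ (-e2) ≤ (t / D) ^ (-e2) :=
            Real.rpow_le_rpow_of_nonpos (by positivity) hk2.le (by linarith)
          rw [← Real.rpow_natCast, ← Real.rpow_mul hM0.le, mul_comm, Real.rpow_mul hM0.le, hθM,
            Real.rpow_natCast] at h1
          calc B * θ ^ k = B / θ * θ ^ (k + 1) := by rw [pow_succ]; field_simp
            _ ≤ _ := mul_le_mul_of_nonneg_left h1 (by positivity)
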